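/- arXiv:2509.17518 — 5 statements merged into one kernel-verified Lean document; each statement's English description precedes it below -/
import Mathlib

section
/- Tail estimate in the critical case α = 2 (equation 3.4): for every integer d ≥ 1 and every t > 0, lim_{M→+∞} limsup_{N→+∞} ∫_{{θ ∈ R^d : M < ‖θ‖_∞ ≤ π √(N log N)}} exp( t N · Σ_{y ∈ Z^d, y ≠ 0} (cos(θ·y / √(N log N)) − 1)/‖y‖₂^{d+2} ) dθ = 0, where N → +∞ is taken over real N > 1. -/
open MeasureTheory Filter Real Topology

/-- Euclidean (l²) norm of a vector in `Fin d → ℝ`. -/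
noncomputable def l2norm {d : ℕ} (u : Fin d → ℝ) : ℝ := Real.sqrt (∑ i, u i ^ 2)

/-- Euclidean norm of a lattice point. -/
noncomputable def zl2 {d : ℕ} (y : Fin d → ℤ) : ℝ := l2norm (fun i => (y i : ℝ))

/-- The symbol `Σ_{y ≠ 0} (cos(θ·y) − 1)/‖y‖₂^{d+α}` of the long-range random walk. -/
noncomputable def latticeSymbol (d : ℕ) (α : ℝ) (θ : Fin d → ℝ) : ℝ :=
  ∑' y : {y : Fin d → ℤ // y ≠ 0},
    (Real.cos (∑ i, θ i * (y.1 i : ℝ)) - 1) / zl2 y.1 ^ ((d : ℝ) + α)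

/-- Transition probability `p_t^{d,α}(0,x)` of the long-range random walk, defined through
the Fourier inversion formula. -/
noncomputable def pTrans (d : ℕ) (α : ℝ) (t : ℝ) (x : Fin d → ℤ) : ℝ :=
  ((2 * Real.pi) ^ d)⁻¹ *
    ∫ θ in Set.univ.pi (fun _ : Fin d => Set.Icc (-Real.pi) Real.pi),
      Real.exp (t * latticeSymbol d α θ) * Real.cos (∑ i, (x i : ℝ) * θ i)

/-- The constant `G̃^{d,α} = ∫_{R^d} (1 − cos v₁)/‖v‖₂^{d+α} dv`. -/
noncomputable def Gtilde (d : ℕ) (α : ℝ) : ℝ :=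
  ∫ v : Fin d → ℝ, (1 - Real.cos (if h : 0 < d then v ⟨0, h⟩ else 0)) / l2norm v ^ ((d : ℝ) + α)

/-- The density `f_t^{d,α}` of the limiting stable law (case `0 < α < 2`). -/
noncomputable def fDensity (d : ℕ) (α : ℝ) (t : ℝ) (u : Fin d → ℝ) : ℝ :=
  ((2 * Real.pi) ^ d)⁻¹ *
    ∫ θ : Fin d → ℝ, Real.cos (∑ i, θ i * u i) * Real.exp (-(t * l2norm θ ^ α * Gtilde d α))

lemma l2norm_nonneg {d : ℕ} (u : Fin d → ℝ) : 0 ≤ l2norm u := Real.sqrt_nonneg _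

lemma norm_le_l2norm {d : ℕ} (u : Fin d → ℝ) : ‖u‖ ≤ l2norm u := by
  refine (pi_norm_le_iff_of_nonneg (l2norm_nonneg u)).2 fun i => ?_
  rw [Real.norm_eq_abs]
  exact Real.abs_le_sqrt (Finset.single_le_sum (f := fun i => u i ^ 2)
    (fun j _ => sq_nonneg (u j)) (Finset.mem_univ i))

lemma l2norm_le_sqrt_mul {d : ℕ} (u : Fin d → ℝ) {r : ℝ} (hr : 0 ≤ r) (hu : ∀ i, |u i| ≤ r) :
    l2norm u ≤ √d * r := by
  rw [l2norm, ← Real.sqrt_sq hr, ← Real.sqrt_mul (Nat.cast_nonneg d)]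
  refine Real.sqrt_le_sqrt ?_
  calc ∑ i, u i ^ 2 ≤ ∑ _i : Fin d, r ^ 2 :=
        Finset.sum_le_sum fun i _ => sq_le_sq' (neg_le_of_abs_le (hu i)) (le_of_abs_le (hu i))
    _ = d * r ^ 2 := by simp

lemma norm_intCast_pos {d : ℕ} {y : Fin d → ℤ} (hy : y ≠ 0) : 0 < ‖fun i => (y i : ℝ)‖ := by
  obtain ⟨i, hi⟩ := Function.ne_iff.1 hy
  rw [norm_pos_iff]
  exact Function.ne_iff.2 ⟨i, Int.cast_ne_zero.2 hi⟩

lemma exists_norm_apply_eq_norm {d : ℕ} (hd : 1 ≤ d) (u : Fin d → ℝ) : ∃ k, |u k| = ‖u‖ := by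
  have : Nonempty (Fin d) := ⟨⟨0, hd⟩⟩
  obtain ⟨k, -, hk⟩ := Finset.exists_mem_eq_sup Finset.univ Finset.univ_nonempty fun i => ‖u i‖₊
  exact ⟨k, by rw [Pi.norm_def, hk, coe_nnnorm, Real.norm_eq_abs]⟩

lemma finrank_span_range_basis {d : ℕ} (b : Module.Basis (Fin d) ℝ (Fin d → ℝ)) :
    Module.finrank ℤ (Submodule.span ℤ (Set.range b)) = d := by
  rw [Module.finrank_eq_card_basis (b.restrictScalars ℤ), Fintype.card_fin]

lemma summable_norm_rpow_of_finrank_eq {d : ℕ} {r : ℝ} (hr : r < -d)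
    (L : Submodule ℤ (Fin d → ℝ)) [DiscreteTopology L] (hL : Module.finrank ℤ L = d) :
    Summable fun z : L => ‖z‖ ^ r :=
  ZLattice.summable_norm_rpow L r (by rwa [hL])

lemma intCast_mem_span_range_basisFun {d : ℕ} (y : Fin d → ℤ) :
    (fun i => (y i : ℝ)) ∈ Submodule.span ℤ (Set.range (Pi.basisFun ℝ (Fin d))) :=
  ((Pi.basisFun ℝ (Fin d)).mem_span_iff_repr_mem ℤ _).2 fun i => ⟨y i, by simp⟩

lemma summable_norm_intCast_rpow {d : ℕ} {r : ℝ} (hr : r < -d) :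
    Summable fun y : Fin d → ℤ => ‖fun i => (y i : ℝ)‖ ^ r := by
  have hs := summable_norm_rpow_of_finrank_eq hr _
    (finrank_span_range_basis (Pi.basisFun ℝ (Fin d)))
  have hg : Function.Injective fun y : Fin d → ℤ =>
      Subtype.mk (fun i => (y i : ℝ)) (intCast_mem_span_range_basisFun y) := fun y z h => by
    funext i
    exact Int.cast_injective (α := ℝ) (congrFun (congrArg Subtype.val h) i)
  exact (hs.comp_injective hg :)

/-- The opposite of the general term of the lattice symbol. -/
noncomputable def symbolTerm (d : ℕ) (α : ℝ) (θ : Fin d → ℝ) (y : Fin d → ℤ) : ℝ :=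
  (1 - Real.cos (∑ i, θ i * (y i : ℝ))) / zl2 y ^ ((d : ℝ) + α)

lemma symbolTerm_nonneg (d : ℕ) (α : ℝ) (θ : Fin d → ℝ) (y : Fin d → ℤ) :
    0 ≤ symbolTerm d α θ y :=
  div_nonneg (sub_nonneg.2 (Real.cos_le_one _)) (Real.rpow_nonneg (l2norm_nonneg _) _)

lemma summable_symbolTerm (d : ℕ) {α : ℝ} (hα : 0 < α) (θ : Fin d → ℝ) :
    Summable (symbolTerm d α θ) := by
  have hs := (summable_norm_intCast_rpow (d := d) (r := -(d + α)) (by linarith)).mul_left 2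
  refine Summable.of_nonneg_of_le (symbolTerm_nonneg d α θ) (fun y => ?_) hs
  rcases eq_or_ne y 0 with rfl | hy
  · simp only [symbolTerm, Pi.zero_apply, Int.cast_zero, mul_zero, Finset.sum_const_zero,
      Real.cos_zero, sub_self, zero_div]
    positivity
  have hpos := norm_intCast_pos hy
  rw [symbolTerm, Real.rpow_neg hpos.le, ← div_eq_mul_inv]
  gcongr
  · linarith [Real.neg_one_le_cos (∑ i, θ i * (y i : ℝ))]
  · exact norm_le_l2norm _

lemma sum_symbolTerm_le_neg_latticeSymbol (d : ℕ) {α : ℝ} (hα : 0 < α) (θ : Fin d → ℝ)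
    (S : Finset (Fin d → ℤ)) : ∑ y ∈ S, symbolTerm d α θ y ≤ -latticeSymbol d α θ := by
  have h : -latticeSymbol d α θ = ∑' y, symbolTerm d α θ y := by
    have hsupp : Function.support (symbolTerm d α θ) ⊆ {y | y ≠ 0} := by
      rintro y hy rfl
      simp [symbolTerm] at hy
    rw [← tsum_subtype_eq_of_support_subset hsupp, latticeSymbol, ← tsum_neg]
    refine tsum_congr fun y => ?_
    rw [symbolTerm, ← neg_div, neg_sub]
  rw [h]
  exact (summable_symbolTerm d hα θ).sum_le_tsum S fun y _ => symbolTerm_nonneg d α θ y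

/-- Lower bound on one term of the symbol. -/
lemma le_symbolTerm {d : ℕ} {α : ℝ} (hα : 0 < α) {θ : Fin d → ℝ} {y : Fin d → ℤ} {a r : ℝ}
    (ha : 0 ≤ a) (hr : 0 ≤ r) (hy : y ≠ 0) (hyr : ∀ i, |(y i : ℝ)| ≤ r)
    (hl : a ≤ ∑ i, θ i * (y i : ℝ)) (hu : ∑ i, θ i * (y i : ℝ) ≤ π) :
    2 / π ^ 2 * a ^ 2 / (√d * r) ^ ((d : ℝ) + α) ≤ symbolTerm d α θ y := by
  have hpos : 0 < zl2 y := (norm_intCast_pos hy).trans_le (norm_le_l2norm _)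
  have hcos := Real.cos_le_one_sub_mul_cos_sq (x := ∑ i, θ i * (y i : ℝ))
    (abs_le.2 ⟨by linarith [Real.pi_pos], hu⟩)
  have hsq : 2 / π ^ 2 * a ^ 2 ≤ 2 / π ^ 2 * (∑ i, θ i * (y i : ℝ)) ^ 2 := by gcongr
  rw [symbolTerm]
  gcongr
  · linarith [Real.cos_le_one (∑ i, θ i * (y i : ℝ))]
  · linarith
  · exact l2norm_le_sqrt_mul _ hr hyr

/-- A sign of `x`, as an integer, equal to `1` at `0`. -/
noncomputable def unitSign (x : ℝ) : ℤ := if 0 ≤ x then 1 else -1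

lemma mul_unitSign (x : ℝ) : x * unitSign x = |x| := by
  unfold unitSign
  split_ifs with h
  · simp [abs_of_nonneg h]
  · simp [abs_of_neg (not_le.1 h)]

lemma abs_unitSign (x : ℝ) : |(unitSign x : ℝ)| = 1 := by
  unfold unitSign
  split_ifs <;> simp

lemma unitSign_ne_zero (x : ℝ) : unitSign x ≠ 0 := by
  unfold unitSign
  split_ifs <;> simp

/-- The lattice point in the orthant of `θ` with coordinates of absolute value `n`. -/
noncomputable def orthantPoint {d : ℕ} (θ : Fin d → ℝ) (n : Fin d → ℕ) (i : Fin d) : ℤ :=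
  unitSign (θ i) * n i

lemma abs_orthantPoint {d : ℕ} (θ : Fin d → ℝ) (n : Fin d → ℕ) (i : Fin d) :
    |(orthantPoint θ n i : ℝ)| = n i := by
  simp [orthantPoint, abs_mul, abs_unitSign]

lemma sum_mul_orthantPoint {d : ℕ} (θ : Fin d → ℝ) (n : Fin d → ℕ) :
    ∑ i, θ i * (orthantPoint θ n i : ℝ) = ∑ i, |θ i| * n i := by
  refine Finset.sum_congr rfl fun i _ => ?_
  rw [orthantPoint, Int.cast_mul, ← mul_assoc, mul_unitSign, Int.cast_natCast]

lemma orthantPoint_injective {d : ℕ} (θ : Fin d → ℝ) : Function.Injective (orthantPoint θ) := by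
  intro n n' h
  funext i
  have := congrFun h i
  simpa [orthantPoint, unitSign_ne_zero] using this

lemma le_symbolTerm_orthantPoint {d : ℕ} {α : ℝ} (hα : 0 < α) {θ : Fin d → ℝ} {n : Fin d → ℕ}
    {k : Fin d} (hk : |θ k| = ‖θ‖) {m : ℕ} (hm : 1 ≤ m) (hnk : n k = m) (hn : ∀ i, n i ≤ m)
    (hu : ∑ i, |θ i| * n i ≤ π) :
    2 / π ^ 2 * (‖θ‖ * m) ^ 2 / (√d * m) ^ ((d : ℝ) + α) ≤
      symbolTerm d α θ (orthantPoint θ n) := by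
  refine le_symbolTerm hα (by positivity) (Nat.cast_nonneg m) ?_ (fun i => ?_) ?_ ?_
  · refine Function.ne_iff.2 ⟨k, ?_⟩
    simp only [orthantPoint, hnk, Pi.zero_apply]
    exact mul_ne_zero (unitSign_ne_zero _) (by omega)
  · rw [abs_orthantPoint]
    exact_mod_cast hn i
  · rw [sum_mul_orthantPoint, ← hk, ← hnk]
    exact Finset.single_le_sum (f := fun i => |θ i| * (n i : ℝ)) (fun i _ => by positivity)
      (Finset.mem_univ k)
  · rwa [sum_mul_orthantPoint]

lemma sq_norm_le_neg_latticeSymbol {d : ℕ} (hd : 1 ≤ d) {α : ℝ} (hα : 0 < α) {θ : Fin d → ℝ}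
    (hθ : ‖θ‖ ≤ π) :
    2 / π ^ 2 / √d ^ ((d : ℝ) + α) * ‖θ‖ ^ 2 ≤ -latticeSymbol d α θ := by
  obtain ⟨k, hk⟩ := exists_norm_apply_eq_norm hd θ
  have h := sum_symbolTerm_le_neg_latticeSymbol d hα θ {orthantPoint θ (Pi.single k 1)}
  rw [Finset.sum_singleton] at h
  refine le_trans ?_ h
  refine le_trans (le_of_eq ?_) (le_symbolTerm_orthantPoint hα hk le_rfl (by simp) (fun i => ?_) ?_)
  · simp only [Nat.cast_one, mul_one]
    ring
  · rcases eq_or_ne i k with rfl | hi <;> simp [*]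
  · rw [Finset.sum_eq_single k (fun i _ hi => by simp [hi]) (by simp)]
    simpa [hk] using hθ

lemma card_piFinset_ite_singleton {d : ℕ} (k : Fin d) (m : ℕ) :
    (Fintype.piFinset fun i : Fin d => if i = k then {m} else Finset.Icc 1 m).card =
      m ^ (d - 1) := by
  rw [Fintype.card_piFinset, ← Finset.mul_prod_erase _ _ (Finset.mem_univ k)]
  rw [Finset.prod_congr rfl (g := fun _ => m)]
  · simp
  · intro i hi
    simp [Finset.ne_of_mem_erase hi]

lemma sq_norm_mul_log_le_neg_latticeSymbol {d : ℕ} (hd : 1 ≤ d) {θ : Fin d → ℝ} (hθ : 0 < ‖θ‖) :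
    2 / π ^ 2 / √d ^ ((d : ℝ) + 2) * ‖θ‖ ^ 2 * Real.log (1 / (d * ‖θ‖)) ≤
      -latticeSymbol d 2 θ := by
  have hd0 : (0 : ℝ) < d := by exact_mod_cast hd
  obtain ⟨k, hk⟩ := exists_norm_apply_eq_norm hd θ
  set R := ⌊1 / (d * ‖θ‖)⌋₊
  let A : ℕ → Finset (Fin d → ℕ) := fun m =>
    Fintype.piFinset fun i : Fin d => if i = k then {m} else Finset.Icc 1 m
  have hA {m : ℕ} {n : Fin d → ℕ} (hm : 1 ≤ m) (hn : n ∈ A m) : n k = m ∧ ∀ i, n i ≤ m := by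
    rw [Fintype.mem_piFinset] at hn
    refine ⟨by simpa using hn k, fun i => ?_⟩
    have := hn i
    split_ifs at this
    · exact (Finset.mem_singleton.1 this).le
    · exact (Finset.mem_Icc.1 this).2
  have hinj : Set.InjOn (fun p : Σ _ : ℕ, Fin d → ℕ => orthantPoint θ p.2)
      ((Finset.Icc 1 R).sigma A) := by
    rintro ⟨m, n⟩ hp ⟨m', n'⟩ hp' h
    obtain rfl : n = n' := orthantPoint_injective θ h
    simp only [Finset.coe_sigma, Set.mem_sigma_iff, Finset.mem_coe, Finset.mem_Icc] at hp hp'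
    obtain rfl : m = m' := (hA hp.1.1 hp.2).1.symm.trans (hA hp'.1.1 hp'.2).1
    rfl
  have hlog : Real.log (1 / (d * ‖θ‖)) ≤ ∑ m ∈ Finset.Icc 1 R, (m : ℝ)⁻¹ := by
    calc Real.log (1 / (d * ‖θ‖)) ≤ Real.log ↑(R + 1) := by
          refine Real.log_le_log (by positivity) ?_
          push_cast
          exact (Nat.lt_floor_add_one _).le
      _ ≤ harmonic R := log_add_one_le_harmonic R
      _ = _ := by simp [harmonic_eq_sum_Icc]
  calc _ ≤ 2 / π ^ 2 / √d ^ ((d : ℝ) + 2) * ‖θ‖ ^ 2 * ∑ m ∈ Finset.Icc 1 R, (m : ℝ)⁻¹ := by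
        gcongr
    _ = ∑ m ∈ Finset.Icc 1 R, ∑ _n ∈ A m,
          2 / π ^ 2 * (‖θ‖ * m) ^ 2 / (√d * m) ^ ((d : ℝ) + 2) := by
        rw [Finset.mul_sum]
        refine Finset.sum_congr rfl fun m hm => ?_
        have hm0 : (0 : ℝ) < m := by exact_mod_cast (Finset.mem_Icc.1 hm).1
        rw [Finset.sum_const, card_piFinset_ite_singleton, nsmul_eq_mul,
          Real.mul_rpow (by positivity) hm0.le]
        have : (m : ℝ) ^ ((d : ℝ) + 2) = (m : ℝ) ^ (d - 1) * m ^ 3 := by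
          rw [← pow_add, ← Real.rpow_natCast]
          congr 1
          rw [show d - 1 + 3 = d + 2 by omega]
          push_cast
          ring
        rw [this]
        push_cast
        have h1 : (0 : ℝ) < √d ^ ((d : ℝ) + 2) := by positivity
        field_simp
    _ ≤ ∑ m ∈ Finset.Icc 1 R, ∑ n ∈ A m, symbolTerm d 2 θ (orthantPoint θ n) := by
        refine Finset.sum_le_sum fun m hm => Finset.sum_le_sum fun n hn => ?_
        rw [Finset.mem_Icc] at hm
        obtain ⟨h1, h2⟩ := hA hm.1 hn
        refine le_symbolTerm_orthantPoint two_pos hk hm.1 h1 h2 ?_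
        have hmR : (m : ℝ) ≤ 1 / (d * ‖θ‖) :=
          (Nat.cast_le.2 hm.2).trans (Nat.floor_le (by positivity))
        calc ∑ i, |θ i| * n i ≤ ∑ _i : Fin d, ‖θ‖ * (1 / (d * ‖θ‖)) := by
              refine Finset.sum_le_sum fun i _ => ?_
              have : (n i : ℝ) ≤ 1 / (d * ‖θ‖) := (Nat.cast_le.2 (h2 i)).trans hmR
              gcongr
              exact norm_le_pi_norm θ i
          _ = 1 := by
              simp only [Finset.sum_const, Finset.card_univ, Fintype.card_fin, nsmul_eq_mul]
              field_simp
          _ ≤ π := by linarith [Real.pi_gt_three]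
    _ = ∑ y ∈ ((Finset.Icc 1 R).sigma A).image fun p => orthantPoint θ p.2,
          symbolTerm d 2 θ y := by
        rw [Finset.sum_image hinj, Finset.sum_sigma]
    _ ≤ _ := sum_symbolTerm_le_neg_latticeSymbol d two_pos θ _

lemma integrable_exp_neg_mul_norm {E : Type*} [NormedAddCommGroup E] [NormedSpace ℝ E]
    [FiniteDimensional ℝ E] [MeasurableSpace E] [BorelSpace E] (μ : Measure E)
    [μ.IsAddHaarMeasure] {c : ℝ} (hc : 0 < c) : Integrable (fun x => Real.exp (-(c * ‖x‖))) μ := by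
  set n := Module.finrank ℝ E + 1
  have h_int : Integrable (fun x : E => (1 + ‖x‖) ^ (-(n : ℝ))) μ :=
    integrable_one_add_norm (by simp [n])
  obtain ⟨K, hK⟩ : ∃ K : ℝ, ∀ s : ℝ, 0 ≤ s → Real.exp (-(c * s)) ≤ K * (1 + s) ^ (-(n : ℝ)) := by
    refine ⟨n.factorial / c ^ n * Real.exp c, fun s hs => ?_⟩
    have h := Real.pow_div_factorial_le_exp (c * (1 + s)) (by positivity) n
    rw [Real.rpow_neg (by positivity), Real.rpow_natCast, Real.exp_neg]
    rw [mul_add, mul_one, Real.exp_add, ← mul_one_add, mul_pow] at h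
    have : 0 < (n.factorial : ℝ) := by positivity
    have : 0 < Real.exp (c * s) := Real.exp_pos _
    rw [inv_le_iff_one_le_mul₀ this]
    rw [div_le_iff₀ (by positivity)] at h
    rw [div_mul_eq_mul_div, div_mul_eq_mul_div, ← div_eq_mul_inv, div_div, div_mul_eq_mul_div,
      le_div_iff₀ (by positivity)]
    linarith
  refine (h_int.const_mul K).mono' (by fun_prop) (Eventually.of_forall fun x => ?_)
  rw [Real.norm_eq_abs, Real.abs_exp]
  exact hK _ (norm_nonneg x)

/-- Linear lower bound for the exponent at scale `√(N log N)`, uniform in `N`. -/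
lemma eventually_mul_norm_le_neg_latticeSymbol {d : ℕ} (hd : 1 ≤ d) :
    ∃ c > 0, ∀ᶠ N : ℝ in atTop, ∀ θ : Fin d → ℝ, 1 ≤ ‖θ‖ →
      ‖θ‖ ≤ π * √(N * Real.log N) →
        c * ‖θ‖ ≤ -(N * latticeSymbol d 2 fun i => θ i / √(N * Real.log N)) := by
  have hd0 : (0 : ℝ) < d := by exact_mod_cast hd
  set C := 2 / π ^ 2 / √d ^ ((d : ℝ) + 2)
  have hC0 : 0 < C := by positivity
  refine ⟨C / 8, by positivity, ?_⟩
  filter_upwards [eventually_ge_atTop (Real.exp 1), eventually_ge_atTop ((d : ℝ) ^ 8)]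
    with N hN hNd θ h1 h2
  have hN1 : 1 < N := lt_of_lt_of_le (by simp) hN
  have hN0 : 0 < N := by linarith
  have hlog : 1 ≤ Real.log N := (Real.le_log_iff_exp_le hN0).2 hN
  set L := √(N * Real.log N) with hL
  have hL0 : 0 < L := by positivity
  have hL2 : L ^ 2 = N * Real.log N := Real.sq_sqrt (by positivity)
  have hθ0 : 0 < ‖θ‖ := by linarith
  set φ : Fin d → ℝ := fun i => θ i / L with hφ
  have hφn : ‖φ‖ = ‖θ‖ / L := by
    have : φ = L⁻¹ • θ := by
      funext i
      simp [hφ, div_eq_inv_mul]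
    rw [this, norm_smul, Real.norm_eq_abs, abs_of_pos (inv_pos.2 hL0), div_eq_inv_mul]
  have hsq : N * (C * ‖φ‖ ^ 2) = C * (‖θ‖ ^ 2 / Real.log N) := by
    rw [hφn, div_pow, hL2]
    field_simp
  have hsqrtN : N ^ (1 / 2 : ℝ) ≤ L := by
    rw [← Real.sqrt_eq_rpow]
    exact Real.sqrt_le_sqrt (by nlinarith)
  rw [← mul_neg]
  rcases le_or_gt ‖θ‖ (N ^ (1 / 4 : ℝ)) with hθ | hθ
  · have h := sq_norm_mul_log_le_neg_latticeSymbol hd (θ := φ) (by rw [hφn]; positivity)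
    have hN8 : (d : ℝ) ≤ N ^ (1 / 8 : ℝ) := by
      calc (d : ℝ) = ((d : ℝ) ^ 8) ^ (1 / 8 : ℝ) := by
            rw [← Real.rpow_natCast, ← Real.rpow_mul hd0.le]
            norm_num
        _ ≤ _ := by gcongr
    have hlog8 : Real.log N / 8 ≤ Real.log (1 / (d * ‖φ‖)) := by
      calc Real.log N / 8 = Real.log (N ^ (1 / 8 : ℝ)) := by
            rw [Real.log_rpow hN0]
            ring
        _ ≤ _ := by
            refine Real.log_le_log (by positivity) ?_
            rw [hφn, le_div_iff₀ (by positivity), mul_div_assoc', mul_div_assoc', div_le_one hL0]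
            calc N ^ (1 / 8 : ℝ) * (d * ‖θ‖)
                ≤ N ^ (1 / 8 : ℝ) * (N ^ (1 / 8 : ℝ) * N ^ (1 / 4 : ℝ)) := by gcongr
              _ = N ^ (1 / 2 : ℝ) := by
                  rw [← Real.rpow_add hN0, ← Real.rpow_add hN0]
                  norm_num
              _ ≤ L := hsqrtN
    calc C / 8 * ‖θ‖ ≤ C / 8 * ‖θ‖ ^ 2 := by
          gcongr
          nlinarith
      _ = N * (C * ‖φ‖ ^ 2) * (Real.log N / 8) := by
          rw [hsq]
          field_simp
      _ ≤ N * (C * ‖φ‖ ^ 2) * Real.log (1 / (d * ‖φ‖)) := by gcongr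
      _ = N * (C * ‖φ‖ ^ 2 * Real.log (1 / (d * ‖φ‖))) := by ring
      _ ≤ _ := by gcongr
  · have h := sq_norm_le_neg_latticeSymbol hd two_pos (θ := φ) (by
      rw [hφn, div_le_iff₀ hL0]
      exact h2)
    have hlog4 : Real.log N ≤ 4 * ‖θ‖ := by
      have := Real.log_le_rpow_div hN0.le (ε := 1 / 4) (by norm_num)
      linarith
    calc C / 8 * ‖θ‖ ≤ C * (‖θ‖ ^ 2 / Real.log N) := by
          rw [div_mul_eq_mul_div, ← mul_div_assoc, div_le_div_iff₀ (by norm_num) (by linarith)]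
          have := mul_le_mul_of_nonneg_left hlog4 (mul_pos hC0 hθ0).le
          nlinarith [mul_pos hC0 (sq_pos_of_pos hθ0)]
      _ = N * (C * ‖φ‖ ^ 2) := hsq.symm
      _ ≤ _ := by gcongr

/-- **Tail estimate in the critical case `α = 2` (equation 3.4)**: for `t > 0`,
`lim_{M→∞} limsup_{N→∞} ∫_{M < ‖θ‖_∞ ≤ π√(N log N)}
  exp(tN Σ_{y≠0}(cos(θ·y/√(N log N))−1)/‖y‖₂^{d+2}) dθ = 0`,
the `limsup` being over real `N → +∞`.  Here `‖θ‖` is the sup (l∞) norm. -/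
theorem tail_estimate_alpha_eq_two (d : ℕ) (hd : 1 ≤ d) (t : ℝ) (ht : 0 < t) :
    Tendsto
      (fun M : ℝ =>
        Filter.limsup
          (fun N : ℝ =>
            ∫ θ in {θ : Fin d → ℝ |
                M < ‖θ‖ ∧ ‖θ‖ ≤ Real.pi * Real.sqrt (N * Real.log N)},
              Real.exp (t * N *
                latticeSymbol d 2 (fun i => θ i / Real.sqrt (N * Real.log N))))
          atTop)
      atTop (𝓝 0) := by
  obtain ⟨c, hc, hbound⟩ := eventually_mul_norm_le_neg_latticeSymbol hd
  set K := ∫ θ : Fin d → ℝ, Real.exp (-(t * c / 2 * ‖θ‖)) with hK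
  have h_int : Integrable (fun θ : Fin d → ℝ => Real.exp (-(t * c / 2 * ‖θ‖))) :=
    integrable_exp_neg_mul_norm volume (by positivity)
  have hnonneg (M N : ℝ) : 0 ≤ ∫ θ in {θ : Fin d → ℝ |
      M < ‖θ‖ ∧ ‖θ‖ ≤ Real.pi * Real.sqrt (N * Real.log N)},
      Real.exp (t * N * latticeSymbol d 2 (fun i => θ i / Real.sqrt (N * Real.log N))) :=
    integral_nonneg fun _ => (Real.exp_pos _).le
  have hupper {M : ℝ} (hM : 1 ≤ M) : ∀ᶠ N : ℝ in atTop, ∫ θ in {θ : Fin d → ℝ |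
      M < ‖θ‖ ∧ ‖θ‖ ≤ Real.pi * Real.sqrt (N * Real.log N)},
      Real.exp (t * N * latticeSymbol d 2 (fun i => θ i / Real.sqrt (N * Real.log N))) ≤
        Real.exp (-(t * c / 2 * M)) * K := by
    filter_upwards [hbound] with N hN
    have hmeas : MeasurableSet {θ : Fin d → ℝ |
        M < ‖θ‖ ∧ ‖θ‖ ≤ Real.pi * Real.sqrt (N * Real.log N)} :=
      (measurableSet_lt measurable_const measurable_norm).inter
        (measurableSet_le measurable_norm measurable_const)
    have h_int' := h_int.const_mul (Real.exp (-(t * c / 2 * M)))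
    rw [hK, ← integral_const_mul]
    refine le_trans (integral_mono_of_nonneg (Eventually.of_forall fun _ => (Real.exp_pos _).le)
      h_int'.integrableOn ?_)
      (setIntegral_le_integral h_int' (Eventually.of_forall fun _ => by positivity))
    filter_upwards [ae_restrict_mem hmeas] with θ hθ
    have h := mul_le_mul_of_nonneg_left (hN θ (hM.trans hθ.1.le) hθ.2) ht.le
    have h' := mul_le_mul_of_nonneg_left hθ.1.le (show 0 ≤ t * c / 2 by positivity)
    rw [← Real.exp_add]
    refine Real.exp_le_exp.2 ?_
    linarith
  have hlim : Tendsto (fun M : ℝ => Real.exp (-(t * c / 2 * M)) * K) atTop (𝓝 0) := by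
    rw [← zero_mul K]
    refine Tendsto.mul_const K (Real.tendsto_exp_neg_atTop_nhds_zero.comp ?_)
    exact tendsto_id.const_mul_atTop (by positivity)
  refine tendsto_of_tendsto_of_tendsto_of_le_of_le' tendsto_const_nhds hlim ?_ ?_
  · filter_upwards [eventually_ge_atTop 1] with M hM
    exact le_limsup_of_frequently_le (Frequently.of_forall (hnonneg M))
      (isBoundedUnder_of_eventually_le (hupper hM))
  · filter_upwards [eventually_ge_atTop 1] with M hM
    exact limsup_le_of_le (isCoboundedUnder_le_of_le atTop (hnonneg M)) (hupper hM)
end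

section
/- Transience characterization of the long-range random walk: for every integer d ≥ 1 and every real α > 0, ∫_0^{+∞} p_t^{d,α}(0,0) dt < +∞ if and only if (d = 1 and 0 < α < 1) or (d = 2 and 0 < α < 2) or d ≥ 3. -/
open MeasureTheory Filter Real Topology

lemma abs_le_zl2 {d : ℕ} (y : Fin d → ℤ) (i : Fin d) : |(y i : ℝ)| ≤ zl2 y :=
  Real.abs_le_sqrt (Finset.single_le_sum (f := fun i => (y i : ℝ) ^ 2)
    (fun _ _ => sq_nonneg _) (Finset.mem_univ i))

lemma zl2_nonneg {d : ℕ} (y : Fin d → ℤ) : 0 ≤ zl2 y := Real.sqrt_nonneg _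

lemma norm_intCast_le_zl2 {d : ℕ} (y : Fin d → ℤ) : ‖fun i => (y i : ℝ)‖ ≤ zl2 y :=
  (pi_norm_le_iff_of_nonneg (zl2_nonneg y)).2 fun i => abs_le_zl2 y i

lemma one_le_zl2 {d : ℕ} {y : Fin d → ℤ} (hy : y ≠ 0) : 1 ≤ zl2 y := by
  obtain ⟨i, hi⟩ := Function.ne_iff.1 hy
  refine le_trans ?_ (abs_le_zl2 y i)
  exact_mod_cast Int.one_le_abs hi

lemma zl2_zero {d : ℕ} : zl2 (0 : Fin d → ℤ) = 0 := by simp [zl2, l2norm]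

lemma zl2_le {d : ℕ} {y : Fin d → ℤ} {K : ℝ} (hK : 0 ≤ K) (h : ∀ i, |(y i : ℝ)| ≤ K) :
    zl2 y ≤ d * K := by
  refine Real.sqrt_le_iff.2 ⟨by positivity, ?_⟩
  calc ∑ i, (y i : ℝ) ^ 2 ≤ ∑ _i : Fin d, K ^ 2 :=
        Finset.sum_le_sum fun i _ => sq_le_sq' (neg_le_of_abs_le (h i)) (le_of_abs_le (h i))
    _ = d * K ^ 2 := by simp
    _ ≤ d ^ 2 * K ^ 2 := by
        gcongr
        exact_mod_cast Nat.le_self_pow two_ne_zero d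
    _ = (d * K) ^ 2 := by ring

lemma summable_inv_zl2_rpow (d : ℕ) {α : ℝ} (hα : 0 < α) :
    Summable fun y : Fin d → ℤ => (zl2 y ^ ((d : ℝ) + α))⁻¹ := by
  let L := Submodule.span ℤ (Set.range (Pi.basisFun ℝ (Fin d)))
  have hrank : Module.finrank ℤ L = d := by
    rw [ZLattice.rank ℝ L]; simp
  have hs : Summable fun z : L => ‖z‖ ^ (-((d : ℝ) + α)) :=
    ZLattice.summable_norm_rpow L _ (by rw [hrank]; linarith)
  have hmem (y : Fin d → ℤ) : (fun i => (y i : ℝ)) ∈ L := by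
    have : (fun i => (y i : ℝ)) = ∑ i, y i • Pi.basisFun ℝ (Fin d) i := by
      ext j
      simp [Finset.sum_apply, Pi.single_apply]
    rw [this]
    exact Submodule.sum_mem _ fun i _ =>
      Submodule.smul_mem _ _ (Submodule.subset_span (Set.mem_range_self i))
  have hinj : Function.Injective fun y : Fin d → ℤ => (⟨fun i => (y i : ℝ), hmem y⟩ : L) := by
    intro y z hyz
    ext i
    have := congrFun (congrArg Subtype.val hyz) i
    simpa using this
  refine Summable.of_nonneg_of_le (fun y => by have := zl2_nonneg y; positivity) (fun y => ?_)
    (hs.comp_injective hinj)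
  rcases eq_or_ne y 0 with rfl | hy
  · rw [zl2_zero, Real.zero_rpow (by positivity), inv_zero]
    exact Real.rpow_nonneg (norm_nonneg _) _
  · have hpos : 0 < ‖fun i => (y i : ℝ)‖ := by
      rw [norm_pos_iff]
      contrapose! hy
      ext i
      simpa using congrFun hy i
    simp only [Function.comp, Submodule.coe_norm]
    rw [Real.rpow_neg hpos.le]
    gcongr
    exact norm_intCast_le_zl2 y

lemma symbol_term_nonneg {d : ℕ} (β : ℝ) (θ : Fin d → ℝ) (y : Fin d → ℤ) :
    0 ≤ (1 - Real.cos (∑ i, θ i * (y i : ℝ))) / zl2 y ^ β :=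
  div_nonneg (sub_nonneg.2 (Real.cos_le_one _)) (Real.rpow_nonneg (zl2_nonneg y) _)

lemma symbol_term_le {d : ℕ} (β : ℝ) (θ : Fin d → ℝ) (y : Fin d → ℤ) :
    (1 - Real.cos (∑ i, θ i * (y i : ℝ))) / zl2 y ^ β ≤ 2 * (zl2 y ^ β)⁻¹ := by
  rw [div_eq_mul_inv]
  have := zl2_nonneg y
  gcongr
  linarith [Real.neg_one_le_cos (∑ i, θ i * (y i : ℝ))]

lemma summable_symbol {d : ℕ} {α : ℝ} (hα : 0 < α) (θ : Fin d → ℝ) :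
    Summable fun y : Fin d → ℤ =>
      (1 - Real.cos (∑ i, θ i * (y i : ℝ))) / zl2 y ^ ((d : ℝ) + α) :=
  Summable.of_nonneg_of_le (symbol_term_nonneg _ θ) (symbol_term_le _ θ)
    ((summable_inv_zl2_rpow d hα).mul_left 2)

lemma neg_latticeSymbol_eq_tsum (d : ℕ) (α : ℝ) (θ : Fin d → ℝ) :
    -latticeSymbol d α θ = ∑' y : Fin d → ℤ,
      (1 - Real.cos (∑ i, θ i * (y i : ℝ))) / zl2 y ^ ((d : ℝ) + α) := by
  rw [latticeSymbol, ← tsum_neg]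
  refine Eq.trans (tsum_congr fun y => ?_) (tsum_subtype_eq_of_support_subset
    (s := {y : Fin d → ℤ | y ≠ 0}) (f := fun y : Fin d → ℤ =>
      (1 - Real.cos (∑ i, θ i * (y i : ℝ))) / zl2 y ^ ((d : ℝ) + α)) ?_)
  · rw [← neg_div, neg_sub]
  · intro y hy
    contrapose! hy
    simp only [Set.mem_ofPred_eq, not_not] at hy
    simp [hy]

lemma latticeSymbol_nonpos (d : ℕ) (α : ℝ) (θ : Fin d → ℝ) : latticeSymbol d α θ ≤ 0 := by
  rw [← neg_nonneg, neg_latticeSymbol_eq_tsum]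
  exact tsum_nonneg (symbol_term_nonneg _ θ)

lemma continuous_latticeSymbol (d : ℕ) {α : ℝ} (hα : 0 < α) :
    Continuous (latticeSymbol d α) := by
  have h : Continuous fun θ => -latticeSymbol d α θ := by
    simp_rw [neg_latticeSymbol_eq_tsum]
    refine continuous_tsum (fun y => ?_) ((summable_inv_zl2_rpow d hα).mul_left 2) fun y θ => ?_
    · fun_prop
    · rw [Real.norm_of_nonneg (symbol_term_nonneg _ θ y)]
      exact symbol_term_le _ θ y
  exact (continuous_congr fun θ => neg_neg (latticeSymbol d α θ)).1 h.neg

lemma univ_pi_Icc_neg_pi (d : ℕ) :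
    (Set.univ.pi fun _ : Fin d => Set.Icc (-Real.pi) Real.pi) = Metric.closedBall 0 π := by
  rw [closedBall_pi _ Real.pi_pos.le]
  simp [Real.closedBall_eq_Icc]

lemma pTrans_zero_eq (d : ℕ) (α t : ℝ) :
    pTrans d α t 0 = ((2 * π) ^ d)⁻¹ *
      ∫ θ in Metric.closedBall (0 : Fin d → ℝ) π, Real.exp (t * latticeSymbol d α θ) := by
  rw [pTrans, univ_pi_Icc_neg_pi]
  simp

lemma lintegral_exp_mul_Ioi {a : ℝ} (ha : a ≤ 0) :
    ∫⁻ t in Set.Ioi (0 : ℝ), ENNReal.ofReal (Real.exp (t * a)) = (ENNReal.ofReal (-a))⁻¹ := by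
  rcases ha.eq_or_lt with rfl | ha
  · simp
  · simp_rw [mul_comm _ a]
    rw [← ofReal_integral_eq_lintegral_ofReal (integrableOn_exp_mul_Ioi ha 0)
      (ae_of_all _ fun _ => (Real.exp_pos _).le), integral_exp_mul_Ioi ha,
      ← ENNReal.ofReal_inv_of_pos (neg_pos.2 ha)]
    congr 1
    simp [neg_div, inv_neg]

lemma integrableOn_pTrans_zero_iff (d : ℕ) {α : ℝ} (hα : 0 < α) :
    IntegrableOn (fun t : ℝ => pTrans d α t (0 : Fin d → ℤ)) (Set.Ioi 0) ↔
      ∫⁻ θ in Metric.closedBall (0 : Fin d → ℝ) π,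
        (ENNReal.ofReal (-latticeSymbol d α θ))⁻¹ < ⊤ := by
  have hc := continuous_latticeSymbol d hα
  have hc2 : Continuous fun p : ℝ × (Fin d → ℝ) => Real.exp (p.1 * latticeSymbol d α p.2) := by
    fun_prop
  have hpos : 0 < ((2 * π) ^ d)⁻¹ := by positivity
  have hnn (t : ℝ) : 0 ≤ ∫ θ in Metric.closedBall (0 : Fin d → ℝ) π,
      Real.exp (t * latticeSymbol d α θ) := integral_nonneg fun _ => (Real.exp_pos _).le
  have hmeas : StronglyMeasurable fun t : ℝ => pTrans d α t (0 : Fin d → ℤ) := by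
    simp_rw [pTrans_zero_eq]
    exact (hc2.stronglyMeasurable.integral_prod_right
      (ν := volume.restrict (Metric.closedBall (0 : Fin d → ℝ) π))).const_mul _
  have hint (t : ℝ) : IntegrableOn (fun θ : Fin d → ℝ => Real.exp (t * latticeSymbol d α θ))
      (Metric.closedBall 0 π) :=
    ContinuousOn.integrableOn_compact (isCompact_closedBall _ _) (by fun_prop)
  rw [IntegrableOn, Integrable, and_iff_right hmeas.aestronglyMeasurable,
    hasFiniteIntegral_iff_ofReal (ae_of_all _ fun t => by
      rw [Pi.zero_apply, pTrans_zero_eq]; exact mul_nonneg hpos.le (hnn t))]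
  have key : ∫⁻ t in Set.Ioi (0 : ℝ), ENNReal.ofReal (pTrans d α t (0 : Fin d → ℤ)) =
      ENNReal.ofReal ((2 * π) ^ d)⁻¹ * ∫⁻ θ in Metric.closedBall (0 : Fin d → ℝ) π,
        (ENNReal.ofReal (-latticeSymbol d α θ))⁻¹ := by
    simp_rw [pTrans_zero_eq, ENNReal.ofReal_mul hpos.le,
      ofReal_integral_eq_lintegral_ofReal (hint _) (ae_of_all _ fun _ => (Real.exp_pos _).le)]
    rw [lintegral_const_mul' _ _ ENNReal.ofReal_ne_top,
      lintegral_lintegral_swap hc2.measurable.ennreal_ofReal.aemeasurable]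
    simp_rw [lintegral_exp_mul_Ioi (latticeSymbol_nonpos d α _)]
  rw [key, ENNReal.mul_lt_top_iff]
  have : ENNReal.ofReal ((2 * π) ^ d)⁻¹ ≠ 0 := by simpa using hpos
  constructor
  · rintro (⟨-, h⟩ | h | h)
    · exact h
    · exact absurd h this
    · simp [h]
  · exact fun h => Or.inl ⟨ENNReal.ofReal_lt_top, h⟩

lemma exists_abs_apply_eq_norm {d : ℕ} (hd : 1 ≤ d) (θ : Fin d → ℝ) : ∃ i, |θ i| = ‖θ‖ := by
  have : Nonempty (Fin d) := ⟨⟨0, hd⟩⟩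
  obtain ⟨i, hi⟩ := Finite.exists_max fun i => ‖θ i‖
  exact ⟨i, le_antisymm (norm_le_pi_norm θ i)
    ((pi_norm_le_iff_of_nonneg (norm_nonneg _)).2 hi)⟩

lemma norm_sq_le_neg_latticeSymbol {d : ℕ} (hd : 1 ≤ d) {α : ℝ} (hα : 0 < α) {θ : Fin d → ℝ}
    (hθ : ‖θ‖ ≤ π) : 2 / π ^ 2 * ‖θ‖ ^ 2 ≤ -latticeSymbol d α θ := by
  obtain ⟨i, hi⟩ := exists_abs_apply_eq_norm hd θ
  rw [neg_latticeSymbol_eq_tsum]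
  refine le_trans ?_ ((summable_symbol hα θ).le_tsum (Pi.single i 1)
    fun y _ => symbol_term_nonneg _ θ y)
  have hz : zl2 (Pi.single i 1 : Fin d → ℤ) = 1 := by
    simp [zl2, l2norm, Pi.single_apply]
  have hs : ∑ j, θ j * ((Pi.single i 1 : Fin d → ℤ) j : ℝ) = θ i := by
    simp [Pi.single_apply]
  rw [hz, hs, Real.one_rpow, div_one, ← hi, sq_abs]
  linarith [Real.cos_le_one_sub_mul_cos_sq (hi.trans_le hθ)]

lemma box_le_neg_latticeSymbol {d : ℕ} (hd : 1 ≤ d) {α : ℝ} (hα : 0 < α) {θ : Fin d → ℝ} {N : ℕ}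
    (hN : 1 ≤ N) (hθ : d * (‖θ‖ * (2 * N)) ≤ π) :
    2 / π ^ 2 * ((2 * d : ℝ) ^ ((d : ℝ) + α))⁻¹ * (‖θ‖ ^ 2 * (N : ℝ) ^ (2 - α)) ≤
      -latticeSymbol d α θ := by
  obtain ⟨i, hi⟩ := exists_abs_apply_eq_norm hd θ
  let B : Finset (Fin d → ℤ) := Fintype.piFinset fun j =>
    if 0 ≤ θ j then Finset.Icc (N : ℤ) (2 * N) else Finset.Icc (-(2 * N) : ℤ) (-N)
  have hcard : (N : ℝ) ^ d ≤ B.card := by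
    have h (j : Fin d) : N ≤ (if 0 ≤ θ j then Finset.Icc (N : ℤ) (2 * N)
        else Finset.Icc (-(2 * N) : ℤ) (-N)).card := by
      split_ifs <;> simp <;> lia
    rw [Fintype.card_piFinset]
    exact_mod_cast (by simpa using
      Finset.prod_le_prod (s := Finset.univ) (fun _ _ => Nat.zero_le _) fun j _ => h j)
  have hB {y : Fin d → ℤ} (hy : y ∈ B) (j : Fin d) :
      θ j * y j = |θ j| * |(y j : ℝ)| ∧ (N : ℝ) ≤ |(y j : ℝ)| ∧ |(y j : ℝ)| ≤ 2 * N := by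
    have hj := Fintype.mem_piFinset.1 hy j
    rw [← abs_mul]
    split_ifs at hj with h
    · obtain ⟨h1, h2⟩ := Finset.mem_Icc.1 hj
      have h1 : (N : ℝ) ≤ y j := by exact_mod_cast h1
      have h2 : (y j : ℝ) ≤ 2 * N := by exact_mod_cast h2
      have h0 : (0 : ℝ) ≤ y j := N.cast_nonneg.trans h1
      rw [abs_of_nonneg (mul_nonneg h h0), abs_of_nonneg h0]
      exact ⟨rfl, h1, h2⟩
    · obtain ⟨h1, h2⟩ := Finset.mem_Icc.1 hj
      have h1 : -(2 * N : ℝ) ≤ y j := by exact_mod_cast h1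
      have h2 : (y j : ℝ) ≤ -N := by exact_mod_cast h2
      have h0 : (y j : ℝ) ≤ 0 := h2.trans (neg_nonpos.2 N.cast_nonneg)
      rw [abs_of_nonneg (mul_nonneg_of_nonpos_of_nonpos (not_le.1 h).le h0), abs_of_nonpos h0]
      exact ⟨rfl, by linarith, by linarith⟩
  have hNpos : (0 : ℝ) < N := by exact_mod_cast hN
  have hdpos : (0 : ℝ) < d := by exact_mod_cast hd
  have hterm {y : Fin d → ℤ} (hy : y ∈ B) :
      2 / π ^ 2 * (‖θ‖ * N) ^ 2 / (d * (2 * N)) ^ ((d : ℝ) + α) ≤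
        (1 - Real.cos (∑ i, θ i * (y i : ℝ))) / zl2 y ^ ((d : ℝ) + α) := by
    have hy0 : y ≠ 0 := by
      rintro rfl
      have := (hB hy i).2.1
      simp at this
      lia
    have hz : 0 < zl2 y := one_pos.trans_le (one_le_zl2 hy0)
    have hsum : ∑ j, θ j * (y j : ℝ) = ∑ j, |θ j| * |(y j : ℝ)| :=
      Finset.sum_congr rfl fun j _ => (hB hy j).1
    have hlow : ‖θ‖ * N ≤ ∑ j, |θ j| * |(y j : ℝ)| :=
      calc ‖θ‖ * N ≤ |θ i| * |(y i : ℝ)| := by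
            rw [hi]; gcongr; exact (hB hy i).2.1
        _ ≤ _ := Finset.single_le_sum (f := fun j => |θ j| * |(y j : ℝ)|)
            (fun j _ => by positivity) (Finset.mem_univ i)
    have hup : ∑ j, |θ j| * |(y j : ℝ)| ≤ π :=
      calc ∑ j, |θ j| * |(y j : ℝ)| ≤ ∑ _j : Fin d, ‖θ‖ * (2 * N) := by
            gcongr with j
            · exact norm_le_pi_norm θ j
            · exact (hB hy j).2.2
        _ = d * (‖θ‖ * (2 * N)) := by simp
        _ ≤ π := hθ
    have hnn : 0 ≤ ∑ j, |θ j| * |(y j : ℝ)| := Finset.sum_nonneg fun j _ => by positivity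
    rw [hsum]
    have hcos : 2 / π ^ 2 * (‖θ‖ * N) ^ 2 ≤ 1 - Real.cos (∑ j, |θ j| * |(y j : ℝ)|) := by
      have := Real.cos_le_one_sub_mul_cos_sq (abs_le.2 ⟨by linarith [Real.pi_pos], hup⟩)
      have : 2 / π ^ 2 * (‖θ‖ * N) ^ 2 ≤ 2 / π ^ 2 * (∑ j, |θ j| * |(y j : ℝ)|) ^ 2 := by gcongr
      linarith
    gcongr
    · exact (by positivity : 0 ≤ 2 / π ^ 2 * (‖θ‖ * N) ^ 2).trans hcos
    · exact zl2_le (by positivity) fun j => (hB hy j).2.2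
  rw [neg_latticeSymbol_eq_tsum]
  refine le_trans ?_ ((summable_symbol hα θ).sum_le_tsum B fun y _ => symbol_term_nonneg _ θ y)
  refine le_trans ?_ (Finset.card_nsmul_le_sum B _ _ fun y hy => hterm hy)
  rw [nsmul_eq_mul]
  refine le_trans (le_of_eq ?_) (mul_le_mul_of_nonneg_right hcard (by positivity))
  rw [show (d : ℝ) * (2 * N) = 2 * d * N by ring, Real.mul_rpow (by positivity) hNpos.le,
    Real.rpow_add hNpos, Real.rpow_sub hNpos, Real.rpow_natCast, Real.rpow_two]
  field_simp

lemma rpow_norm_le_neg_latticeSymbol {d : ℕ} (hd : 1 ≤ d) {α : ℝ} (hα : 0 < α) (hα2 : α < 2)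
    {θ : Fin d → ℝ} (hθ : ‖θ‖ ≤ π) :
    2 / π ^ 2 * ((2 * d : ℝ) ^ ((d : ℝ) + 2))⁻¹ * ‖θ‖ ^ α ≤ -latticeSymbol d α θ := by
  rcases (norm_nonneg θ).eq_or_lt with h0 | hM
  · rw [← h0, Real.zero_rpow hα.ne', mul_zero]
    exact neg_nonneg.2 (latticeSymbol_nonpos d α θ)
  have hd1 : (1 : ℝ) ≤ d := by exact_mod_cast hd
  have hd0 : (0 : ℝ) < d := by linarith
  have hsplit : ‖θ‖ ^ 2 = ‖θ‖ ^ α * ‖θ‖ ^ (2 - α) := by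
    rw [← Real.rpow_add hM, add_sub_cancel, Real.rpow_two]
  rcases le_or_gt (d * ‖θ‖) 1 with hsmall | hbig
  · have hx : 1 ≤ (d * ‖θ‖)⁻¹ := (one_le_inv₀ (by positivity)).2 hsmall
    set N := ⌊(d * ‖θ‖)⁻¹⌋₊
    have hN1 : 1 ≤ N := (Nat.one_le_floor_iff _).2 hx
    have hNle : (N : ℝ) ≤ (d * ‖θ‖)⁻¹ := Nat.floor_le (by positivity)
    have hNge : (2 * d : ℝ)⁻¹ * ‖θ‖⁻¹ ≤ (N : ℝ) := by
      have h1 := Nat.lt_floor_add_one (d * ‖θ‖)⁻¹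
      have h2 : (1 : ℝ) ≤ N := by exact_mod_cast hN1
      have h3 : (2 * d : ℝ)⁻¹ * ‖θ‖⁻¹ = (d * ‖θ‖)⁻¹ / 2 := by field_simp
      rw [h3]
      linarith
    refine le_trans ?_ (box_le_neg_latticeSymbol hd hα hN1 ?_)
    · have hpow : ((2 * d : ℝ)⁻¹ * ‖θ‖⁻¹) ^ (2 - α) ≤ (N : ℝ) ^ (2 - α) := by
        gcongr
      rw [Real.mul_rpow (by positivity) (by positivity), Real.inv_rpow (by positivity),
        Real.inv_rpow hM.le] at hpow
      calc 2 / π ^ 2 * ((2 * d : ℝ) ^ ((d : ℝ) + 2))⁻¹ * ‖θ‖ ^ α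
          = 2 / π ^ 2 * ((2 * d : ℝ) ^ ((d : ℝ) + α))⁻¹ *
              (‖θ‖ ^ 2 * (((2 * d : ℝ) ^ (2 - α))⁻¹ * (‖θ‖ ^ (2 - α))⁻¹)) := by
            rw [hsplit, show (d : ℝ) + 2 = (d + α) + (2 - α) by ring,
              Real.rpow_add (by positivity)]
            field_simp
        _ ≤ _ := by gcongr
    · have h1 : d * ‖θ‖ * N ≤ 1 := by
        rwa [← le_inv_mul_iff₀ (by positivity), mul_one]
      linarith [Real.pi_gt_three]
  · refine le_trans ?_ (norm_sq_le_neg_latticeSymbol hd hα hθ)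
    rw [hsplit, mul_assoc, mul_comm (‖θ‖ ^ α)]
    gcongr
    calc ((2 * d : ℝ) ^ ((d : ℝ) + 2))⁻¹ = ((2 * d : ℝ)⁻¹) ^ ((d : ℝ) + 2) :=
          (Real.inv_rpow (by positivity) _).symm
      _ ≤ ((2 * d : ℝ)⁻¹) ^ (2 - α) :=
          Real.rpow_le_rpow_of_exponent_ge (by positivity)
            (inv_le_one_of_one_le₀ (by linarith)) (by linarith)
      _ ≤ ‖θ‖ ^ (2 - α) := by
          gcongr
          rw [inv_le_iff_one_le_mul₀ (by positivity)]
          linarith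

lemma lintegral_inv_lt_top_of_rpow_le {d : ℕ} (hd : 1 ≤ d) {f : (Fin d → ℝ) → ℝ} {c β : ℝ}
    (hc : 0 < c) (hβ : β < d) (hf : ∀ θ, ‖θ‖ ≤ π → c * ‖θ‖ ^ β ≤ f θ) :
    ∫⁻ θ in Metric.closedBall (0 : Fin d → ℝ) π, (ENNReal.ofReal (f θ))⁻¹ < ⊤ := by
  have : Nonempty (Fin d) := ⟨⟨0, hd⟩⟩
  have hint : IntegrableOn (fun θ : Fin d → ℝ => c⁻¹ * ‖θ‖ ^ (-β)) (Metric.ball 0 4) := by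
    refine integrableOn_ball_of_norm_le_rpow (C := c⁻¹) (α := β) (by simpa using hd)
      (by simpa using hβ) (ae_of_all _ fun θ => ?_)
      ((measurable_norm.pow_const _).const_mul _).aestronglyMeasurable
    rw [Real.norm_of_nonneg (by positivity)]
  have hint' := hint.mono_set
    (Metric.closedBall_subset_ball (x := (0 : Fin d → ℝ)) (by linarith [Real.pi_lt_four] : π < 4))
  have hlt := (hasFiniteIntegral_iff_ofReal (ae_of_all _ fun θ => by
    simp only [Pi.zero_apply]; positivity)).1 hint'.2
  refine lt_of_le_of_lt (lintegral_mono_ae ?_) hlt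
  have hne : ∀ᵐ θ : Fin d → ℝ ∂volume.restrict (Metric.closedBall 0 π), θ ≠ 0 :=
    ae_restrict_of_ae (by simp [ae_iff])
  filter_upwards [hne, ae_restrict_mem Metric.isClosed_closedBall.measurableSet] with θ h0 hθ
  have hpos : 0 < c * ‖θ‖ ^ β := mul_pos hc (Real.rpow_pos_of_pos (norm_pos_iff.2 h0) _)
  rw [Real.rpow_neg (norm_nonneg _), ← mul_inv, ENNReal.ofReal_inv_of_pos hpos]
  exact ENNReal.inv_le_inv.2 (ENNReal.ofReal_le_ofReal (hf θ (by simpa using hθ)))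

lemma sum_one_sub_cos_mul_le {w : ℕ → ℝ} (hw : ∀ n, 0 ≤ w n)
    (hanti : ∀ m n, 1 ≤ m → m ≤ n → w n ≤ w m) {s M : ℝ} (hM : 0 < M) (hs : |s| ≤ M) (K : ℕ) :
    ∑ n ∈ Finset.range K, (1 - Real.cos (s * n)) * (w n * ((n : ℝ) ^ 2)⁻¹) ≤
      M ^ 2 / 2 * ∑ n ∈ Finset.range ⌊M⁻¹⌋₊, w (n + 1) + 4 * w (⌊M⁻¹⌋₊ + 1) * M := by
  set N := ⌊M⁻¹⌋₊
  have hN : M⁻¹ < N + 1 := Nat.lt_floor_add_one _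
  have hcos (x : ℝ) : 0 ≤ 1 - Real.cos x := sub_nonneg.2 (Real.cos_le_one x)
  have hnn (n : ℕ) : 0 ≤ (1 - Real.cos (s * n)) * (w n * ((n : ℝ) ^ 2)⁻¹) :=
    mul_nonneg (hcos _) (mul_nonneg (hw n) (by positivity))
  have hsub : Finset.range K ⊆ Finset.range (N + 1) ∪ Finset.Ioo N K := by
    intro n
    simp only [Finset.mem_union, Finset.mem_range, Finset.mem_Ioo]
    lia
  have hdisj : Disjoint (Finset.range (N + 1)) (Finset.Ioo N K) := by
    rw [Finset.disjoint_left]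
    intro n
    simp only [Finset.mem_range, Finset.mem_Ioo]
    lia
  refine (Finset.sum_le_sum_of_subset_of_nonneg hsub fun n _ _ => hnn n).trans ?_
  rw [Finset.sum_union hdisj]
  gcongr ?_ + ?_
  · rw [Finset.sum_range_succ', Finset.mul_sum]
    simp only [Nat.cast_zero, mul_zero, Real.cos_zero, sub_self, zero_mul, add_zero]
    refine Finset.sum_le_sum fun n _ => ?_
    have h1 : 1 - Real.cos (s * (n + 1 : ℕ)) ≤ M ^ 2 / 2 * ((n + 1 : ℕ) : ℝ) ^ 2 := by
      have h2 := Real.one_sub_sq_div_two_le_cos (x := s * (n + 1 : ℕ))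
      have h3 : s ^ 2 ≤ M ^ 2 := sq_le_sq' (neg_le_of_abs_le hs) (le_of_abs_le hs)
      nlinarith [sq_nonneg ((n + 1 : ℕ) : ℝ), mul_pow s ((n + 1 : ℕ) : ℝ) 2]
    calc _ ≤ M ^ 2 / 2 * ((n + 1 : ℕ) : ℝ) ^ 2 * (w (n + 1) * (((n + 1 : ℕ) : ℝ) ^ 2)⁻¹) :=
          mul_le_mul_of_nonneg_right h1 (mul_nonneg (hw _) (by positivity))
      _ = _ := by
          have : ((n + 1 : ℕ) : ℝ) ≠ 0 := by positivity
          field_simp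
  · calc ∑ n ∈ Finset.Ioo N K, (1 - Real.cos (s * n)) * (w n * ((n : ℝ) ^ 2)⁻¹)
        ≤ ∑ n ∈ Finset.Ioo N K, 2 * (w (N + 1) * ((n : ℝ) ^ 2)⁻¹) := by
          refine Finset.sum_le_sum fun n hn => ?_
          gcongr
          · exact mul_nonneg (hw _) (by positivity)
          · linarith [Real.neg_one_le_cos (s * n)]
          · exact hanti _ _ (by lia) (Finset.mem_Ioo.1 hn).1
      _ = 2 * w (N + 1) * ∑ n ∈ Finset.Ioo N K, ((n : ℝ) ^ 2)⁻¹ := by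
          simp_rw [← mul_assoc, ← Finset.mul_sum]
      _ ≤ 2 * w (N + 1) * (2 / (N + 1)) := by
          have := hw (N + 1)
          gcongr
          exact sum_Ioo_inv_sq_le N K
      _ ≤ 4 * w (N + 1) * M := by
          have h : (N + 1 : ℝ)⁻¹ ≤ M := inv_le_of_inv_le₀ hM hN.le
          rw [div_eq_mul_inv]
          nlinarith [mul_le_mul_of_nonneg_left h (hw (N + 1))]

lemma tsum_one_sub_cos_div_sq_le {s M : ℝ} (hM : 0 < M) (hM1 : M ≤ 1) (hs : |s| ≤ M) :
    ∑' n : ℕ, ENNReal.ofReal ((1 - Real.cos (s * n)) / (n : ℝ) ^ 2) ≤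
      ENNReal.ofReal (5 * (M * (1 - Real.log M))) := by
  refine ENNReal.tsum_le_of_sum_range_le fun K => ?_
  rw [← ENNReal.ofReal_sum_of_nonneg fun n _ => div_nonneg (sub_nonneg.2 (Real.cos_le_one _))
    (by positivity)]
  refine ENNReal.ofReal_le_ofReal ?_
  have h := sum_one_sub_cos_mul_le (w := fun _ => 1) (fun _ => zero_le_one)
    (fun _ _ _ _ => le_rfl) hM hs K
  simp only [one_mul, Finset.sum_const, Finset.card_range, nsmul_eq_mul,
    mul_one] at h
  simp_rw [← div_eq_mul_inv] at h
  have hN : M * (⌊M⁻¹⌋₊ : ℝ) ≤ 1 := by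
    rw [← le_inv_mul_iff₀ hM, mul_one]
    exact Nat.floor_le (by positivity)
  nlinarith [Real.log_nonpos hM.le hM1]

lemma tsum_one_sub_cos_div_cube_le {s M : ℝ} (hM : 0 < M) (hM1 : M ≤ 1) (hs : |s| ≤ M) :
    ∑' n : ℕ, ENNReal.ofReal ((1 - Real.cos (s * n)) / (n : ℝ) ^ 3) ≤
      ENNReal.ofReal (5 * (M ^ 2 * (1 - Real.log M))) := by
  refine ENNReal.tsum_le_of_sum_range_le fun K => ?_
  rw [← ENNReal.ofReal_sum_of_nonneg fun n _ => div_nonneg (sub_nonneg.2 (Real.cos_le_one _))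
    (by positivity)]
  refine ENNReal.ofReal_le_ofReal ?_
  have h := sum_one_sub_cos_mul_le (w := fun n => (n : ℝ)⁻¹) (fun _ => by positivity)
    (fun m n hm hmn => by gcongr) hM hs K
  simp_rw [← mul_inv, ← pow_succ', ← div_eq_mul_inv] at h
  set N := ⌊M⁻¹⌋₊
  have hN1 : 1 ≤ N := (Nat.one_le_floor_iff _).2 ((one_le_inv₀ hM).2 hM1)
  have hharm : ∑ n ∈ Finset.range N, ((n + 1 : ℕ) : ℝ)⁻¹ ≤ 1 - Real.log M := by
    have h1 := harmonic_le_one_add_log N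
    have h2 : Real.log N ≤ Real.log M⁻¹ :=
      Real.log_le_log (by exact_mod_cast hN1) (Nat.floor_le (by positivity))
    rw [Real.log_inv] at h2
    simp only [harmonic, Rat.cast_sum, Rat.cast_inv, Rat.cast_natCast] at h1
    linarith
  have hinv : ((N + 1 : ℕ) : ℝ)⁻¹ ≤ M :=
    inv_le_of_inv_le₀ hM (by exact_mod_cast (Nat.lt_floor_add_one M⁻¹).le)
  have h3 : M ^ 2 / 2 * ∑ n ∈ Finset.range N, ((n + 1 : ℕ) : ℝ)⁻¹ ≤
      M ^ 2 / 2 * (1 - Real.log M) := by gcongr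
  simp only [Nat.reduceAdd] at h
  rw [div_eq_mul_inv 4] at h
  have h4 : 4 * ((N + 1 : ℕ) : ℝ)⁻¹ * M ≤ 4 * M * M := by gcongr
  nlinarith [mul_nonneg (sq_nonneg M) (neg_nonneg.2 (Real.log_nonpos hM.le hM1))]

lemma tsum_int_natAbs_le (g : ℕ → ENNReal) : ∑' n : ℤ, g n.natAbs ≤ 2 * ∑' n, g n := by
  have h := (HasSum.of_nat_of_neg_add_one (f := fun n : ℤ => g n.natAbs)
    ENNReal.summable.hasSum ENNReal.summable.hasSum).tsum_eq
  rw [h, two_mul]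
  refine add_le_add (by simp) ?_
  calc ∑' n : ℕ, g (-((n : ℤ) + 1)).natAbs = ∑' n : ℕ, g (n + 1) :=
        tsum_congr fun n => by congr 1
    _ ≤ ∑' n, g n := ENNReal.tsum_comp_le_tsum_of_injective (add_left_injective 1) g

lemma tsum_fin_two_natAbs_le (F : ℕ → ℕ → ENNReal) :
    ∑' y : Fin 2 → ℤ, F (y 0).natAbs (y 1).natAbs ≤ 4 * ∑' a, ∑' b, F a b :=
  calc ∑' y : Fin 2 → ℤ, F (y 0).natAbs (y 1).natAbs
      = ∑' p : ℤ × ℤ, F p.1.natAbs p.2.natAbs :=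
        (finTwoArrowEquiv ℤ).tsum_eq fun p : ℤ × ℤ => F p.1.natAbs p.2.natAbs
    _ = ∑' m : ℤ, ∑' n : ℤ, F m.natAbs n.natAbs :=
        ENNReal.tsum_prod (f := fun m n : ℤ => F m.natAbs n.natAbs)
    _ ≤ ∑' m : ℤ, 2 * ∑' b, F m.natAbs b :=
        ENNReal.tsum_le_tsum fun m => tsum_int_natAbs_le (F m.natAbs)
    _ ≤ 2 * ∑' a, 2 * ∑' b, F a b := tsum_int_natAbs_le fun a => 2 * ∑' b, F a b
    _ = 4 * ∑' a, ∑' b, F a b := by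
        rw [ENNReal.tsum_mul_left, ← mul_assoc]
        norm_num

lemma tsum_inv_add_pow_four_le {a : ℕ} (ha : 1 ≤ a) :
    ∑' b : ℕ, ENNReal.ofReal (((a : ℝ) + b) ^ 4)⁻¹ ≤ ENNReal.ofReal (2 / (a : ℝ) ^ 3) := by
  refine ENNReal.tsum_le_of_sum_range_le fun K => ?_
  rw [← ENNReal.ofReal_sum_of_nonneg fun n _ => by positivity]
  refine ENNReal.ofReal_le_ofReal ?_
  have ha0 : (0 : ℝ) < a := by exact_mod_cast ha
  calc ∑ b ∈ Finset.range K, (((a : ℝ) + b) ^ 4)⁻¹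
      ≤ ∑ b ∈ Finset.range K, ((a : ℝ) ^ 2)⁻¹ * (((a + b : ℕ) : ℝ) ^ 2)⁻¹ := by
        refine Finset.sum_le_sum fun b _ => ?_
        rw [← mul_inv, Nat.cast_add]
        gcongr
        rw [show 4 = 2 + 2 from rfl, pow_add]
        gcongr
        linarith [b.cast_nonneg (α := ℝ)]
    _ = ((a : ℝ) ^ 2)⁻¹ * ∑ n ∈ Finset.Ioo (a - 1) (a + K), ((n : ℝ) ^ 2)⁻¹ := by
        have : Finset.Ioo (a - 1) (a + K) = Finset.Ico a (a + K) := by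
          ext n
          simp only [Finset.mem_Ioo, Finset.mem_Ico]
          lia
        rw [this, Finset.sum_Ico_eq_sum_range, add_tsub_cancel_left, Finset.mul_sum]
    _ ≤ ((a : ℝ) ^ 2)⁻¹ * (2 / ((a - 1 : ℕ) + 1)) := by
        gcongr
        exact sum_Ioo_inv_sq_le _ _
    _ = 2 / (a : ℝ) ^ 3 := by
        rw [Nat.cast_sub ha]
        field_simp
        simp [Nat.ne_of_gt ha]

lemma tsum_tsum_one_sub_cos_le {s M : ℝ} (hM : 0 < M) (hM1 : M ≤ 1) (hs : |s| ≤ M) :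
    ∑' a : ℕ, ∑' b : ℕ, ENNReal.ofReal ((1 - Real.cos (s * a)) * (((a : ℝ) + b) ^ 4)⁻¹) ≤
      ENNReal.ofReal (10 * (M ^ 2 * (1 - Real.log M))) := by
  have hcos (x : ℝ) : 0 ≤ 1 - Real.cos x := sub_nonneg.2 (Real.cos_le_one x)
  calc _ ≤ ∑' a : ℕ, ENNReal.ofReal 2 * ENNReal.ofReal ((1 - Real.cos (s * a)) / (a : ℝ) ^ 3) := by
        refine ENNReal.tsum_le_tsum fun a => ?_
        rcases Nat.eq_zero_or_pos a with rfl | ha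
        · simp
        · simp_rw [ENNReal.ofReal_mul (hcos _), ENNReal.tsum_mul_left]
          rw [← ENNReal.ofReal_mul zero_le_two, mul_div_left_comm, ENNReal.ofReal_mul (hcos _)]
          gcongr
          exact tsum_inv_add_pow_four_le ha
    _ ≤ ENNReal.ofReal 2 * ENNReal.ofReal (5 * (M ^ 2 * (1 - Real.log M))) := by
        rw [ENNReal.tsum_mul_left]
        gcongr
        exact tsum_one_sub_cos_div_cube_le hM hM1 hs
    _ = _ := by
        rw [← ENNReal.ofReal_mul zero_le_two]
        congr 1
        ring

lemma cos_mul_natAbs (s : ℝ) (n : ℤ) : Real.cos (s * n.natAbs) = Real.cos (s * n) := by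
  rw [Nat.cast_natAbs, Int.cast_abs]
  rcases abs_choice (n : ℝ) with h | h <;> simp [h]

lemma neg_latticeSymbol_le_of_tsum_le {d : ℕ} {α : ℝ} (hα : 0 < α) (hdα : (d : ℝ) ≤ α)
    {θ : Fin d → ℝ} {B : ℝ} (hB : 0 ≤ B)
    (h : ∑' y : Fin d → ℤ, ENNReal.ofReal
      ((1 - Real.cos (∑ i, θ i * (y i : ℝ))) / zl2 y ^ (2 * d)) ≤ ENNReal.ofReal B) :
    -latticeSymbol d α θ ≤ B := by
  rw [← ENNReal.ofReal_le_ofReal_iff hB, neg_latticeSymbol_eq_tsum,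
    ENNReal.ofReal_tsum_of_nonneg (symbol_term_nonneg _ θ) (summable_symbol hα θ)]
  refine (ENNReal.tsum_le_tsum fun y => ENNReal.ofReal_le_ofReal ?_).trans h
  rcases eq_or_ne y 0 with rfl | hy
  · simp
  · have h1 := one_le_zl2 hy
    have h0 : 0 < zl2 y := by linarith
    have hcos : 0 ≤ 1 - Real.cos (∑ i, θ i * (y i : ℝ)) := sub_nonneg.2 (Real.cos_le_one _)
    gcongr
    rw [← Real.rpow_natCast]
    refine Real.rpow_le_rpow_of_exponent_le h1 ?_
    push_cast
    linarith

lemma neg_latticeSymbol_one_le {α : ℝ} (hα : 1 ≤ α) {θ : Fin 1 → ℝ} (h0 : 0 < ‖θ‖)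
    (h1 : ‖θ‖ ≤ 1) :
    -latticeSymbol 1 α θ ≤ 10 * ‖θ‖ ^ 1 * (1 - Real.log ‖θ‖) := by
  have hlog := Real.log_nonpos h0.le h1
  have hB : 0 ≤ 1 - Real.log ‖θ‖ := by linarith
  refine neg_latticeSymbol_le_of_tsum_le (by linarith) (by simpa using hα) (by positivity) ?_
  calc ∑' y : Fin 1 → ℤ, ENNReal.ofReal
        ((1 - Real.cos (∑ i, θ i * (y i : ℝ))) / zl2 y ^ (2 * 1))
      = ∑' y : Fin 1 → ℤ, ENNReal.ofReal
        ((1 - Real.cos (θ 0 * ((y 0).natAbs : ℕ))) / ((y 0).natAbs : ℝ) ^ 2) := by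
        refine tsum_congr fun y => ?_
        rw [cos_mul_natAbs]
        simp [zl2, l2norm, Real.sqrt_sq_eq_abs]
    _ = ∑' n : ℤ, ENNReal.ofReal
        ((1 - Real.cos (θ 0 * (n.natAbs : ℕ))) / (n.natAbs : ℝ) ^ 2) :=
        (Equiv.funUnique (Fin 1) ℤ).tsum_eq fun n : ℤ => ENNReal.ofReal
          ((1 - Real.cos (θ 0 * (n.natAbs : ℕ))) / (n.natAbs : ℝ) ^ 2)
    _ ≤ 2 * ∑' n : ℕ, ENNReal.ofReal ((1 - Real.cos (θ 0 * n)) / (n : ℝ) ^ 2) :=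
        tsum_int_natAbs_le fun n => ENNReal.ofReal ((1 - Real.cos (θ 0 * n)) / (n : ℝ) ^ 2)
    _ ≤ ENNReal.ofReal 2 * ENNReal.ofReal (5 * (‖θ‖ * (1 - Real.log ‖θ‖))) := by
        rw [ENNReal.ofReal_ofNat]
        gcongr
        exact tsum_one_sub_cos_div_sq_le h0 h1 (norm_le_pi_norm θ 0)
    _ = _ := by
        rw [← ENNReal.ofReal_mul zero_le_two]
        congr 1
        ring

lemma one_sub_cos_add_le (a b : ℝ) :
    1 - Real.cos (a + b) ≤ 2 * (1 - Real.cos a) + 2 * (1 - Real.cos b) := by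
  rw [Real.cos_add]
  nlinarith [Real.sin_sq_add_cos_sq a, Real.sin_sq_add_cos_sq b,
    sq_nonneg (Real.cos a + Real.cos b - 2), sq_nonneg (Real.sin a - Real.sin b),
    sq_nonneg (Real.sin a + Real.sin b), sq_nonneg (Real.cos a - Real.cos b)]

lemma symbol_term_two_le (θ : Fin 2 → ℝ) (y : Fin 2 → ℤ) :
    (1 - Real.cos (∑ i, θ i * (y i : ℝ))) / zl2 y ^ 4 ≤
      8 * ((1 - Real.cos (θ 0 * ((y 0).natAbs : ℕ))) *
        ((((y 0).natAbs : ℝ) + ((y 1).natAbs : ℕ)) ^ 4)⁻¹) +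
      8 * ((1 - Real.cos (θ 1 * ((y 1).natAbs : ℕ))) *
        ((((y 1).natAbs : ℝ) + ((y 0).natAbs : ℕ)) ^ 4)⁻¹) := by
  rcases eq_or_ne y 0 with rfl | hy
  · simp
  rw [cos_mul_natAbs, cos_mul_natAbs, Nat.cast_natAbs, Nat.cast_natAbs, Int.cast_abs, Int.cast_abs,
    add_comm |(y 1 : ℝ)|, Fin.sum_univ_two]
  have hz : 0 < zl2 y := one_pos.trans_le (one_le_zl2 hy)
  have hsq : zl2 y ^ 2 = (y 0 : ℝ) ^ 2 + (y 1 : ℝ) ^ 2 := by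
    rw [zl2, l2norm, Real.sq_sqrt (Finset.sum_nonneg fun _ _ => sq_nonneg _), Fin.sum_univ_two]
  set t := |(y 0 : ℝ)| + |(y 1 : ℝ)|
  have ht : t ^ 2 ≤ 2 * zl2 y ^ 2 := by
    rw [hsq, ← sq_abs (y 0 : ℝ), ← sq_abs (y 1 : ℝ)]
    nlinarith [sq_nonneg (|(y 0 : ℝ)| - |(y 1 : ℝ)|)]
  have htpos : 0 < t := by
    have h2 : zl2 y ^ 2 ≤ t ^ 2 := by
      rw [hsq, ← sq_abs (y 0 : ℝ), ← sq_abs (y 1 : ℝ)]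
      nlinarith [mul_nonneg (abs_nonneg (y 0 : ℝ)) (abs_nonneg (y 1 : ℝ))]
    have h3 : 0 ≤ t := by positivity
    exact hz.trans_le ((sq_le_sq₀ hz.le h3).1 h2)
  have ht4 : t ^ 4 ≤ 4 * zl2 y ^ 4 := by
    nlinarith [mul_self_le_mul_self (sq_nonneg t) ht]
  have hinv : (zl2 y ^ 4)⁻¹ ≤ 4 * (t ^ 4)⁻¹ := by
    rw [← div_eq_mul_inv, inv_le_comm₀ (by positivity) (by positivity), inv_div]
    linarith
  rw [div_eq_mul_inv]
  calc (1 - Real.cos (θ 0 * (y 0 : ℝ) + θ 1 * (y 1 : ℝ))) * (zl2 y ^ 4)⁻¹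
      ≤ (2 * (1 - Real.cos (θ 0 * (y 0 : ℝ))) + 2 * (1 - Real.cos (θ 1 * (y 1 : ℝ)))) *
          (4 * (t ^ 4)⁻¹) := by
        refine mul_le_mul (one_sub_cos_add_le _ _) hinv (by positivity) ?_
        linarith [Real.cos_le_one (θ 0 * (y 0 : ℝ)), Real.cos_le_one (θ 1 * (y 1 : ℝ))]
    _ = _ := by ring

lemma neg_latticeSymbol_two_le {α : ℝ} (hα : 2 ≤ α) {θ : Fin 2 → ℝ} (h0 : 0 < ‖θ‖)
    (h1 : ‖θ‖ ≤ 1) :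
    -latticeSymbol 2 α θ ≤ 640 * ‖θ‖ ^ 2 * (1 - Real.log ‖θ‖) := by
  have hlog := Real.log_nonpos h0.le h1
  have hB : 0 ≤ 1 - Real.log ‖θ‖ := by linarith
  have hcos (x : ℝ) : 0 ≤ 1 - Real.cos x := sub_nonneg.2 (Real.cos_le_one x)
  let F (s : ℝ) (a b : ℕ) : ENNReal :=
    ENNReal.ofReal ((1 - Real.cos (s * a)) * (((a : ℝ) + b) ^ 4)⁻¹)
  have hF (i : Fin 2) : ∑' a, ∑' b, F (θ i) a b ≤
      ENNReal.ofReal (10 * (‖θ‖ ^ 2 * (1 - Real.log ‖θ‖))) :=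
    tsum_tsum_one_sub_cos_le h0 h1 (norm_le_pi_norm θ i)
  refine neg_latticeSymbol_le_of_tsum_le (by linarith) (by simpa using hα) (by positivity) ?_
  calc ∑' y : Fin 2 → ℤ, ENNReal.ofReal
        ((1 - Real.cos (∑ i, θ i * (y i : ℝ))) / zl2 y ^ (2 * 2))
      ≤ ∑' y : Fin 2 → ℤ, (8 * F (θ 0) (y 0).natAbs (y 1).natAbs +
          8 * F (θ 1) (y 1).natAbs (y 0).natAbs) := by
        refine ENNReal.tsum_le_tsum fun y => ?_
        refine (ENNReal.ofReal_le_ofReal (symbol_term_two_le θ y)).trans (le_of_eq ?_)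
        have hnn (i j : Fin 2) : 0 ≤ (1 - Real.cos (θ i * ((y i).natAbs : ℕ))) *
            ((((y i).natAbs : ℝ) + ((y j).natAbs : ℕ)) ^ 4)⁻¹ :=
          mul_nonneg (hcos _) (by positivity)
        rw [ENNReal.ofReal_add (mul_nonneg (by norm_num) (hnn 0 1))
          (mul_nonneg (by norm_num) (hnn 1 0))]
        congr 1 <;> rw [ENNReal.ofReal_mul (by norm_num), ENNReal.ofReal_ofNat]
    _ = 8 * ∑' y : Fin 2 → ℤ, F (θ 0) (y 0).natAbs (y 1).natAbs +
          8 * ∑' y : Fin 2 → ℤ, F (θ 1) (y 1).natAbs (y 0).natAbs := by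
        rw [ENNReal.tsum_add, ENNReal.tsum_mul_left, ENNReal.tsum_mul_left]
    _ ≤ 8 * (4 * ∑' a, ∑' b, F (θ 0) a b) + 8 * (4 * ∑' b, ∑' a, F (θ 1) a b) := by
        gcongr
        · exact tsum_fin_two_natAbs_le (F (θ 0))
        · exact tsum_fin_two_natAbs_le fun a b => F (θ 1) b a
    _ ≤ 8 * (4 * ENNReal.ofReal (10 * (‖θ‖ ^ 2 * (1 - Real.log ‖θ‖)))) +
          8 * (4 * ENNReal.ofReal (10 * (‖θ‖ ^ 2 * (1 - Real.log ‖θ‖)))) := by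
        rw [ENNReal.tsum_comm (f := fun b a => F (θ 1) a b)]
        gcongr
        · exact hF 0
        · exact hF 1
    _ = ENNReal.ofReal 64 * ENNReal.ofReal (10 * (‖θ‖ ^ 2 * (1 - Real.log ‖θ‖))) := by
        rw [ENNReal.ofReal_ofNat]
        ring
    _ = _ := by
        rw [← ENNReal.ofReal_mul (by norm_num)]
        congr 1
        ring

lemma not_integrableOn_inv_mul_one_sub_log :
    ¬ IntegrableOn (fun r : ℝ => (r * (1 - Real.log r))⁻¹) (Set.Ioo 0 1) := by
  have hlog : ∀ᶠ r : ℝ in 𝓝[>] 0, 0 < r ∧ 0 < 1 - Real.log r := by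
    filter_upwards [Ioo_mem_nhdsGT one_pos] with r hr
    exact ⟨hr.1, by linarith [Real.log_nonpos hr.1.le hr.2.le]⟩
  have hderiv : ∀ᶠ r : ℝ in 𝓝[>] 0, HasDerivAt (fun r => Real.log (1 - Real.log r))
      (-(r * (1 - Real.log r))⁻¹) r := by
    filter_upwards [hlog] with r hr
    convert ((Real.hasDerivAt_log hr.1.ne').const_sub 1).log hr.2.ne' using 1
    rw [mul_inv, neg_div, div_eq_mul_inv]
  refine not_integrableOn_of_tendsto_norm_atTop_of_deriv_isBigO_filter
    (f := fun r => Real.log (1 - Real.log r)) (𝓝[>] (0 : ℝ)) (Ioo_mem_nhdsGT one_pos)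
    (hderiv.mono fun r hr => hr.differentiableAt) ?_ ?_
  · refine tendsto_norm_atTop_atTop.comp (Real.tendsto_log_atTop.comp ?_)
    exact tendsto_atTop_add_const_left _ 1 (tendsto_neg_atBot_atTop.comp
      Real.tendsto_log_nhdsGT_zero)
  · refine Asymptotics.IsBigO.of_bound 1 ?_
    filter_upwards [hderiv] with r hr
    rw [hr.deriv, norm_neg, one_mul]

lemma lintegral_inv_eq_top_of_le_mul_log {d : ℕ} (hd : 1 ≤ d) {f : (Fin d → ℝ) → ℝ} {C : ℝ}
    (hC : 0 < C)
    (hf : ∀ θ, 0 < ‖θ‖ → ‖θ‖ ≤ 1 → f θ ≤ C * ‖θ‖ ^ d * (1 - Real.log ‖θ‖)) :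
    ∫⁻ θ in Metric.closedBall (0 : Fin d → ℝ) π, (ENNReal.ofReal (f θ))⁻¹ = ⊤ := by
  by_contra htop
  have : Nonempty (Fin d) := ⟨⟨0, hd⟩⟩
  let g (r : ℝ) : ℝ := (C * r ^ d * (1 - Real.log r))⁻¹
  have hg0 {r : ℝ} (h0 : 0 ≤ r) (h1 : r ≤ 1) : 0 ≤ g r := by
    have : 0 ≤ 1 - Real.log r := by linarith [Real.log_nonpos h0 h1]
    positivity
  have hmeas : Measurable g := by fun_prop
  have hint : IntegrableOn (fun θ : Fin d → ℝ => g ‖θ‖) (Metric.ball 0 1) := by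
    refine ⟨(hmeas.comp measurable_norm).aestronglyMeasurable, ?_⟩
    rw [hasFiniteIntegral_iff_ofReal]
    · refine lt_of_le_of_lt ?_ (lt_top_iff_ne_top.2 htop)
      refine le_trans (setLIntegral_mono' Metric.isOpen_ball.measurableSet fun θ hθ => ?_)
        (lintegral_mono_set (Metric.ball_subset_closedBall.trans
          (Metric.closedBall_subset_closedBall (by linarith [Real.pi_gt_three] : (1 : ℝ) ≤ π))))
      have h1 : ‖θ‖ < 1 := by simpa using hθ
      rcases (norm_nonneg θ).eq_or_lt with h0 | h0
      · simp [g, ← h0, (by lia : d ≠ 0)]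
      · have hpos : 0 < 1 - Real.log ‖θ‖ := by linarith [Real.log_nonpos h0.le h1.le]
        rw [ENNReal.ofReal_inv_of_pos (by positivity)]
        exact ENNReal.inv_le_inv.2 (ENNReal.ofReal_le_ofReal (hf θ h0 h1.le))
    · filter_upwards [ae_restrict_mem Metric.isOpen_ball.measurableSet] with θ hθ
      exact hg0 (norm_nonneg _) (by simpa using (Metric.mem_ball.1 hθ).le)
  have h := (integrableOn_fun_norm_addHaar volume).1 hint
  refine not_integrableOn_inv_mul_one_sub_log ?_
  refine IntegrableOn.congr_fun (h.const_mul C) (fun r hr => ?_) measurableSet_Ioo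
  have hr0 := hr.1
  simp only [Module.finrank_fin_fun, smul_eq_mul, g]
  obtain ⟨k, rfl⟩ := Nat.exists_eq_add_of_le' hd
  rw [add_tsub_cancel_right, pow_succ]
  have hpos : 0 < 1 - Real.log r := by linarith [Real.log_nonpos hr.1.le hr.2.le]
  field_simp

/-- **Transience characterization**: `∫_0^∞ p_t^{d,α}(0,0) dt < ∞` iff
`(d = 1 ∧ α < 1) ∨ (d = 2 ∧ α < 2) ∨ d ≥ 3`. -/
theorem transience_characterization (d : ℕ) (hd : 1 ≤ d) (α : ℝ) (hα : 0 < α) :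
    IntegrableOn (fun t : ℝ => pTrans d α t (0 : Fin d → ℤ)) (Set.Ioi 0) ↔
      (d = 1 ∧ α < 1) ∨ (d = 2 ∧ α < 2) ∨ 3 ≤ d := by
  rw [integrableOn_pTrans_zero_iff d hα]
  have hd0 : (0 : ℝ) < d := by exact_mod_cast hd
  constructor
  · contrapose!
    rintro ⟨h1, h2, h3⟩
    rw [top_le_iff]
    obtain rfl | rfl : d = 1 ∨ d = 2 := by lia
    · exact lintegral_inv_eq_top_of_le_mul_log hd (by norm_num)
        fun θ => neg_latticeSymbol_one_le (h1 rfl)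
    · exact lintegral_inv_eq_top_of_le_mul_log hd (by norm_num)
        fun θ => neg_latticeSymbol_two_le (h2 rfl)
  · intro h
    by_cases h3 : 3 ≤ d
    · refine lintegral_inv_lt_top_of_rpow_le hd (c := 2 / π ^ 2) (β := 2) (by positivity)
        (by exact_mod_cast h3) fun θ hθ => ?_
      rw [Real.rpow_two]
      exact norm_sq_le_neg_latticeSymbol hd hα hθ
    · have hαd : α < d ∧ α < 2 := by
        rcases h with ⟨rfl, h⟩ | ⟨rfl, h⟩ | h
        · exact ⟨by simpa using h, by linarith⟩
        · exact ⟨by simpa using h, h⟩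
        · exact absurd h h3
      exact lintegral_inv_lt_top_of_rpow_le hd (by positivity) hαd.1
        fun θ hθ => rpow_norm_le_neg_latticeSymbol hd hα hαd.2 hθ
end

section
/- Green's function formula in dimension one (equation A.2): for every real α with 0 < α < 1 and every x ∈ Z, ∫_0^{+∞} p_s^{1,α}(0,x) ds = (1/(2π)) ∫_{−π}^{π} cos(xθ) / ( Σ_{y ∈ Z, y ≠ 0} (1 − cos(θ y))/|y|^{1+α} ) dθ, and both sides are finite. -/
open MeasureTheory Filter Real Topology

/-- The one-dimensional symbol `∑_{y ≠ 0} (1 − cos (θ y)) / |y|^{1+α}`, with nonnegative sign. -/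
noncomputable def intSymbol (α θ : ℝ) : ℝ :=
  ∑' y : {y : ℤ // y ≠ 0}, (1 - Real.cos (θ * (y.1 : ℝ))) / |(y.1 : ℝ)| ^ (1 + α)

lemma intSymbol_term_nonneg (α θ : ℝ) (y : {y : ℤ // y ≠ 0}) :
    0 ≤ (1 - Real.cos (θ * (y.1 : ℝ))) / |(y.1 : ℝ)| ^ (1 + α) :=
  div_nonneg (sub_nonneg.2 (Real.cos_le_one _)) (by positivity)

lemma intSymbol_term_le (α θ : ℝ) (y : {y : ℤ // y ≠ 0}) :
    (1 - Real.cos (θ * (y.1 : ℝ))) / |(y.1 : ℝ)| ^ (1 + α) ≤ 2 * |(y.1 : ℝ)| ^ (-(1 + α)) := by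
  rw [Real.rpow_neg (abs_nonneg _), ← div_eq_mul_inv]
  gcongr
  linarith [Real.neg_one_le_cos (θ * (y.1 : ℝ))]

lemma summable_two_mul_abs_int_rpow {α : ℝ} (hα : 0 < α) :
    Summable fun y : {y : ℤ // y ≠ 0} => 2 * |(y.1 : ℝ)| ^ (-(1 + α)) :=
  ((Real.summable_abs_int_rpow (b := 1 + α) (by linarith)).mul_left 2).subtype _

lemma summable_intSymbol {α : ℝ} (hα : 0 < α) (θ : ℝ) :
    Summable fun y : {y : ℤ // y ≠ 0} =>
      (1 - Real.cos (θ * (y.1 : ℝ))) / |(y.1 : ℝ)| ^ (1 + α) :=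
  (summable_two_mul_abs_int_rpow hα).of_nonneg_of_le
    (intSymbol_term_nonneg α θ) (intSymbol_term_le α θ)

lemma continuous_intSymbol {α : ℝ} (hα : 0 < α) : Continuous (intSymbol α) := by
  refine continuous_tsum (fun y => by fun_prop) (summable_two_mul_abs_int_rpow hα) fun y θ => ?_
  rw [Real.norm_of_nonneg (intSymbol_term_nonneg α θ y)]
  exact intSymbol_term_le α θ y

/-- The embedding of the positive integers into the nonzero integers, indexed by `ℕ`. -/
def succNonzeroInt : ℕ ↪ {y : ℤ // y ≠ 0} where
  toFun n := ⟨n + 1, by omega⟩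
  inj' m n h := by simpa using h

lemma le_intSymbol {α : ℝ} (hα : 0 < α) {θ : ℝ} (hθ : θ ≠ 0) (hπ : |θ| ≤ π) :
    (|θ| / π) ^ α / 2 ≤ intSymbol α θ := by
  have hθ' : 0 < |θ| := abs_pos.2 hθ
  set N : ℕ := ⌊π / |θ|⌋₊ with hN
  have hN1 : 1 ≤ N := Nat.le_floor (by rw [Nat.cast_one, le_div_iff₀ hθ']; linarith)
  have hN1' : (1 : ℝ) ≤ N := by exact_mod_cast hN1
  have hNle : (N : ℝ) ≤ π / |θ| := Nat.floor_le (by positivity)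
  have hNlt : π / |θ| < N + 1 := Nat.lt_floor_add_one _
  have hsum : ∀ n : ℕ, ∑ k ∈ Finset.range n, ((k : ℝ) + 1) = n * (n + 1) / 2 := by
    intro n
    induction n with
    | zero => simp
    | succ n ih => rw [Finset.sum_range_succ, ih]; push_cast; ring
  have hterm : ∀ k ∈ Finset.range N, 2 / π ^ 2 * θ ^ 2 * (|θ| / π) ^ α * ((k : ℝ) + 1) ≤
      (1 - Real.cos (θ * ((succNonzeroInt k).1 : ℝ))) /
        |((succNonzeroInt k).1 : ℝ)| ^ (1 + α) := by
    intro k hk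
    have hkN : (k : ℝ) + 1 ≤ N := by exact_mod_cast Finset.mem_range.1 hk
    have hk0 : (0 : ℝ) < k + 1 := by positivity
    have hcast : ((succNonzeroInt k).1 : ℝ) = k + 1 := by
      rw [show (succNonzeroInt k).1 = (k : ℤ) + 1 from rfl]
      push_cast
      rfl
    rw [hcast, abs_of_pos hk0, le_div_iff₀ (by positivity)]
    have hkθ : ((k : ℝ) + 1) ≤ π / |θ| := hkN.trans hNle
    have hcos := Real.cos_le_one_sub_mul_cos_sq (x := θ * ((k : ℝ) + 1)) (by
      rw [abs_mul, abs_of_pos hk0, mul_comm]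
      exact (le_div_iff₀ hθ').1 hkθ)
    have hpow : (|θ| / π) ^ α * ((k : ℝ) + 1) ^ α ≤ 1 := by
      rw [← Real.mul_rpow (by positivity) hk0.le]
      refine Real.rpow_le_one (by positivity) ?_ hα.le
      rw [div_mul_eq_mul_div, div_le_one Real.pi_pos, mul_comm]
      exact (le_div_iff₀ hθ').1 hkθ
    rw [Real.rpow_add hk0, Real.rpow_one]
    calc 2 / π ^ 2 * θ ^ 2 * (|θ| / π) ^ α * ((k : ℝ) + 1) * (((k : ℝ) + 1) * ((k : ℝ) + 1) ^ α)
        = 2 / π ^ 2 * (θ * ((k : ℝ) + 1)) ^ 2 * ((|θ| / π) ^ α * ((k : ℝ) + 1) ^ α) := by ring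
      _ ≤ 2 / π ^ 2 * (θ * ((k : ℝ) + 1)) ^ 2 * 1 := by gcongr
      _ ≤ 1 - Real.cos (θ * ((k : ℝ) + 1)) := by linarith
  have hquad : 1 / 2 ≤ 2 / π ^ 2 * θ ^ 2 * ((N : ℝ) * (N + 1) / 2) := by
    have h1 : π ≤ |θ| * (N + 1) := by
      rw [mul_comm]; exact ((div_lt_iff₀ hθ').1 hNlt).le
    have h2 : π ^ 2 ≤ θ ^ 2 * ((N : ℝ) + 1) ^ 2 := by
      rw [← sq_abs θ, ← mul_pow]; gcongr
    have h3 : θ ^ 2 * ((N : ℝ) + 1) ^ 2 ≤ θ ^ 2 * (2 * (N * (N + 1))) := by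
      gcongr; nlinarith
    rw [show 2 / π ^ 2 * θ ^ 2 * ((N : ℝ) * (N + 1) / 2) = θ ^ 2 * (N * (N + 1)) / π ^ 2 by ring,
      le_div_iff₀ (by positivity)]
    linarith
  calc (|θ| / π) ^ α / 2 = (|θ| / π) ^ α * (1 / 2) := by ring
    _ ≤ (|θ| / π) ^ α * (2 / π ^ 2 * θ ^ 2 * ((N : ℝ) * (N + 1) / 2)) := by gcongr
    _ = ∑ k ∈ Finset.range N, 2 / π ^ 2 * θ ^ 2 * (|θ| / π) ^ α * ((k : ℝ) + 1) := by
        rw [← Finset.mul_sum, hsum]; ring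
    _ ≤ ∑ k ∈ Finset.range N, (1 - Real.cos (θ * ((succNonzeroInt k).1 : ℝ))) /
        |((succNonzeroInt k).1 : ℝ)| ^ (1 + α) := Finset.sum_le_sum hterm
    _ = ∑ y ∈ (Finset.range N).map succNonzeroInt,
        (1 - Real.cos (θ * (y.1 : ℝ))) / |(y.1 : ℝ)| ^ (1 + α) := by rw [Finset.sum_map]
    _ ≤ intSymbol α θ :=
        (summable_intSymbol hα θ).sum_le_tsum _ fun y _ => intSymbol_term_nonneg α θ y

lemma intSymbol_pos {α : ℝ} (hα : 0 < α) {θ : ℝ} (hθ : θ ≠ 0) (hπ : |θ| ≤ π) :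
    0 < intSymbol α θ := by
  have := abs_pos.2 hθ
  exact lt_of_lt_of_le (by positivity) (le_intSymbol hα hθ hπ)

lemma integrableOn_abs_rpow_neg {α : ℝ} (hα : α < 1) (a : ℝ) (ha : 0 ≤ a) :
    IntegrableOn (fun θ : ℝ => |θ| ^ (-α)) (Set.Icc (-a) a) := by
  have h1 : IntervalIntegrable (fun θ : ℝ => |θ| ^ (-α)) volume 0 a := by
    refine (intervalIntegral.intervalIntegrable_rpow' (r := -α) (by linarith)).congr ?_
    intro θ hθ
    rw [Set.uIoc_of_le ha] at hθ
    simp only [abs_of_pos hθ.1]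
  have h2 : IntervalIntegrable (fun θ : ℝ => |θ| ^ (-α)) volume (-a) 0 := by
    have := (IntervalIntegrable.iff_comp_neg).1 h1
    simpa using this.symm
  exact (intervalIntegrable_iff_integrableOn_Icc_of_le (by linarith)).1 (h2.trans h1)

lemma integrableOn_inv_intSymbol {α : ℝ} (hα0 : 0 < α) (hα1 : α < 1) :
    IntegrableOn (fun θ : ℝ => (intSymbol α θ)⁻¹) (Set.Icc (-π) π) := by
  refine Integrable.mono' ((integrableOn_abs_rpow_neg hα1 π Real.pi_pos.le).const_mul (2 * π ^ α))
    (continuous_intSymbol hα0).measurable.inv.aestronglyMeasurable ?_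
  filter_upwards [ae_restrict_mem measurableSet_Icc,
    ae_restrict_of_ae (Measure.ae_ne volume (0 : ℝ))] with θ hθ hne
  have hπ : |θ| ≤ π := abs_le.2 hθ
  have h0 : 0 < |θ| := abs_pos.2 hne
  rw [Real.norm_of_nonneg (inv_nonneg.2 (intSymbol_pos hα0 hne hπ).le)]
  refine (inv_anti₀ (by positivity) (le_intSymbol hα0 hne hπ)).trans_eq ?_
  rw [Real.div_rpow h0.le Real.pi_pos.le, Real.rpow_neg h0.le]
  field_simp

lemma integrableOn_cos_div_intSymbol {α : ℝ} (hα0 : 0 < α) (hα1 : α < 1) (x : ℝ) :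
    IntegrableOn (fun θ : ℝ => Real.cos (x * θ) / intSymbol α θ) (Set.Icc (-π) π) := by
  refine Integrable.mono (integrableOn_inv_intSymbol hα0 hα1)
    ((by fun_prop : Measurable fun θ : ℝ => Real.cos (x * θ)).div
      (continuous_intSymbol hα0).measurable).aestronglyMeasurable (ae_of_all _ fun θ => ?_)
  rw [norm_div, norm_inv, div_eq_mul_inv]
  exact mul_le_of_le_one_left (by positivity) (Real.abs_cos_le_one _)

lemma zl2_fin_one (y : Fin 1 → ℤ) : zl2 y = |(y 0 : ℝ)| := by
  simp [zl2, l2norm, Real.sqrt_sq_eq_abs]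

lemma latticeSymbol_one (α : ℝ) (θ : Fin 1 → ℝ) :
    latticeSymbol 1 α θ = -intSymbol α (θ 0) := by
  let e : {y : Fin 1 → ℤ // y ≠ 0} ≃ {y : ℤ // y ≠ 0} :=
    (Equiv.funUnique (Fin 1) ℤ).subtypeEquiv fun y => by
      simp [funext_iff]
  rw [latticeSymbol, intSymbol, ← tsum_neg, ← e.tsum_eq]
  refine tsum_congr fun y => ?_
  have he : (e y).1 = y.1 0 := rfl
  rw [he, zl2_fin_one, Fin.sum_univ_one, Nat.cast_one]
  ring

lemma pTrans_one (α t : ℝ) (x : Fin 1 → ℤ) :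
    pTrans 1 α t x = (2 * π)⁻¹ * ∫ θ in Set.Icc (-π) π,
      Real.exp (-intSymbol α θ * t) * Real.cos ((x 0 : ℝ) * θ) := by
  have hmp := volume_preserving_funUnique (Fin 1) ℝ
  rw [pTrans, pow_one, ← hmp.setIntegral_preimage_emb
    (MeasurableEquiv.funUnique (Fin 1) ℝ).measurableEmbedding]
  have hset : (Set.univ.pi fun _ : Fin 1 => Set.Icc (-π) π) =
      MeasurableEquiv.funUnique (Fin 1) ℝ ⁻¹' Set.Icc (-π) π := by
    ext θ
    simp only [Set.mem_univ_pi, Set.mem_preimage, Fin.forall_fin_one]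
    rfl
  rw [hset]
  congr 2 with θ
  rw [latticeSymbol_one, Fin.sum_univ_one, mul_comm t]
  rfl

lemma integrable_prod_exp_intSymbol {α : ℝ} (hα0 : 0 < α) (hα1 : α < 1) (x : ℝ) :
    Integrable (fun p : ℝ × ℝ => Real.exp (-intSymbol α p.2 * p.1) * Real.cos (x * p.2))
      ((volume.restrict (Set.Ioi 0)).prod (volume.restrict (Set.Icc (-π) π))) := by
  have hc := continuous_intSymbol hα0
  have hexp : Integrable (fun p : ℝ × ℝ => Real.exp (-intSymbol α p.2 * p.1))
      ((volume.restrict (Set.Ioi 0)).prod (volume.restrict (Set.Icc (-π) π))) := by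
    refine (integrable_prod_iff' (by
      exact (by fun_prop : Continuous fun p : ℝ × ℝ =>
        Real.exp (-intSymbol α p.2 * p.1)).aestronglyMeasurable)).2 ⟨?_, ?_⟩
    · filter_upwards [ae_restrict_mem measurableSet_Icc,
        ae_restrict_of_ae (Measure.ae_ne volume (0 : ℝ))] with θ hθ hne
      exact integrableOn_exp_mul_Ioi (neg_neg_of_pos (intSymbol_pos hα0 hne (abs_le.2 hθ))) 0
    · refine (integrableOn_inv_intSymbol hα0 hα1).congr ?_
      filter_upwards [ae_restrict_mem measurableSet_Icc,
        ae_restrict_of_ae (Measure.ae_ne volume (0 : ℝ))] with θ hθ hne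
      simp only [Real.norm_eq_abs, Real.abs_exp]
      rw [integral_exp_mul_Ioi (neg_neg_of_pos (intSymbol_pos hα0 hne (abs_le.2 hθ)))]
      simp [neg_div_neg_eq]
  refine hexp.mono (by
    exact (by fun_prop : Continuous fun p : ℝ × ℝ =>
      Real.exp (-intSymbol α p.2 * p.1) * Real.cos (x * p.2)).aestronglyMeasurable)
    (ae_of_all _ fun p => ?_)
  rw [norm_mul]
  exact mul_le_of_le_one_right (norm_nonneg _) (Real.abs_cos_le_one _)

lemma integral_exp_intSymbol_mul_cos {α : ℝ} (hα0 : 0 < α) (hα1 : α < 1) (x : ℝ) :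
    ∫ s in Set.Ioi (0 : ℝ), ∫ θ in Set.Icc (-π) π,
        Real.exp (-intSymbol α θ * s) * Real.cos (x * θ) =
      ∫ θ in Set.Icc (-π) π, Real.cos (x * θ) / intSymbol α θ := by
  rw [integral_integral_swap (integrable_prod_exp_intSymbol hα0 hα1 x)]
  refine integral_congr_ae ?_
  filter_upwards [ae_restrict_mem measurableSet_Icc,
    ae_restrict_of_ae (Measure.ae_ne volume (0 : ℝ))] with θ hθ hne
  rw [integral_mul_const,
    integral_exp_mul_Ioi (neg_neg_of_pos (intSymbol_pos hα0 hne (abs_le.2 hθ)))]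
  simp [div_eq_inv_mul]

/-- **Green's function formula in dimension one (equation A.2)**: for `0 < α < 1` and `x ∈ Z`,
`∫_0^∞ p_s^{1,α}(0,x) ds = (2π)⁻¹ ∫_{−π}^{π} cos(xθ) / (Σ_{y≠0}(1−cos(θy))/|y|^{1+α}) dθ`,
and both sides are finite (i.e. both integrands are integrable). -/
theorem green_function_formula_d1 (α : ℝ) (hα0 : 0 < α) (hα1 : α < 1) (x : ℤ) :
    IntegrableOn (fun s : ℝ => pTrans 1 α s (fun _ : Fin 1 => x)) (Set.Ioi 0) ∧
    IntegrableOn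
      (fun θ : ℝ => Real.cos ((x : ℝ) * θ) /
        ∑' y : {y : ℤ // y ≠ 0}, (1 - Real.cos (θ * (y.1 : ℝ))) / |(y.1 : ℝ)| ^ (1 + α))
      (Set.Icc (-Real.pi) Real.pi) ∧
    (∫ s in Set.Ioi (0 : ℝ), pTrans 1 α s (fun _ : Fin 1 => x)) =
      (2 * Real.pi)⁻¹ *
        ∫ θ in Set.Icc (-Real.pi) Real.pi,
          Real.cos ((x : ℝ) * θ) /
            ∑' y : {y : ℤ // y ≠ 0}, (1 - Real.cos (θ * (y.1 : ℝ))) / |(y.1 : ℝ)| ^ (1 + α) := by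
  simp only [pTrans_one]
  refine ⟨(integrable_prod_exp_intSymbol hα0 hα1 x).integral_prod_left.const_mul _,
    integrableOn_cos_div_intSymbol hα0 hα1 x, ?_⟩
  rw [integral_const_mul, integral_exp_intSymbol_mul_cos hα0 hα1]
  rfl
end

section
/- Green's function asymptotics (equation 4.10 for d = 1): for every real α with 1/2 < α < 1, lim_{|x|→+∞, x ∈ Z} |x|^{1−α} · ∫_0^{+∞} p_s^{1,α}(0,x) ds = (1/(2π)) · lim_{T→+∞} ∫_{−T}^{T} cos θ / ( G̃^{1,α} · |θ|^{α} ) dθ, and this limit is a finite, strictly positive real number. -/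
open MeasureTheory Filter Real Topology

namespace LongRangeWalk

/-- The kernel `min (|u|^(-a)) (c |u|^(-b))` used as an integrable majorant. -/
noncomputable def kernel (a b c u : ℝ) : ℝ := min (|u| ^ (-a)) (c * |u| ^ (-b))

lemma kernel_nonneg {a b c : ℝ} (hc : 0 ≤ c) (u : ℝ) : 0 ≤ kernel a b c u := by
  unfold kernel; positivity

lemma measurable_kernel (a b c : ℝ) : Measurable (kernel a b c) := by
  unfold kernel; fun_prop

lemma integrable_comp_abs {f : ℝ → ℝ} (hf : IntegrableOn f (Set.Ioi 0)) :
    Integrable fun x => f |x| := by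
  have h1 : IntegrableOn (fun x => f |x|) (Set.Ioi 0) :=
    hf.congr_fun (fun x hx => by rw [abs_of_pos hx]) measurableSet_Ioi
  have h2 : IntegrableOn (fun x => f |x|) (Set.Iic 0) := by
    rw [← Measure.map_neg_eq_self (volume : Measure ℝ)]
    have m : MeasurableEmbedding fun x : ℝ => -x := (Homeomorph.neg ℝ).measurableEmbedding
    rw [m.integrableOn_map_iff]
    simp_rw [Function.comp_def, abs_neg, Set.neg_preimage, Set.neg_Iic, neg_zero]
    exact Iff.mpr integrableOn_Ici_iff_integrableOn_Ioi h1
  rw [← integrableOn_univ, ← Set.Iic_union_Ioi (a := (0 : ℝ))]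
  exact h2.union h1

lemma integrable_kernel {a b c : ℝ} (ha : a < 1) (hb : 1 < b) (hc : 0 ≤ c) :
    Integrable (kernel a b c) := by
  have key : IntegrableOn (fun u : ℝ => min (u ^ (-a)) (c * u ^ (-b))) (Set.Ioi 0) := by
    have hmeas : Measurable fun u : ℝ => min (u ^ (-a)) (c * u ^ (-b)) := by fun_prop
    rw [← Set.Ioc_union_Ioi_eq_Ioi zero_le_one]
    refine IntegrableOn.union ?_ ?_
    · have h : IntegrableOn (fun u : ℝ => u ^ (-a)) (Set.Ioc 0 1) := by
        rw [← intervalIntegrable_iff_integrableOn_Ioc_of_le zero_le_one]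
        exact intervalIntegral.intervalIntegrable_rpow' (by linarith)
      refine h.mono' hmeas.aestronglyMeasurable ?_
      filter_upwards [ae_restrict_mem measurableSet_Ioc] with u hu
      have hu0 : 0 < u := hu.1
      rw [Real.norm_of_nonneg (by positivity)]
      exact min_le_left _ _
    · refine ((integrableOn_Ioi_rpow_of_lt (a := -b) (by linarith) one_pos).const_mul c).mono'
        hmeas.aestronglyMeasurable ?_
      filter_upwards [ae_restrict_mem measurableSet_Ioi] with u hu
      have hu0 : 0 < u := one_pos.trans hu
      rw [Real.norm_of_nonneg (by positivity)]
      exact min_le_right _ _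
  exact integrable_comp_abs key

lemma kernel_anti {a b c u v : ℝ} (ha : 0 ≤ a) (hb : 0 ≤ b) (hc : 0 ≤ c) (hu : 0 < u)
    (huv : u ≤ v) : kernel a b c v ≤ kernel a b c u := by
  unfold kernel
  rw [abs_of_pos hu, abs_of_pos (hu.trans_le huv)]
  have h1 := Real.rpow_le_rpow_of_nonpos hu huv (neg_nonpos.2 ha)
  have h2 := Real.rpow_le_rpow_of_nonpos hu huv (neg_nonpos.2 hb)
  gcongr

/-- `s` rounded up to the grid `δ ℕ`. -/
noncomputable def gridCeil (δ s : ℝ) : ℝ := ⌈s / δ⌉₊ * δ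

lemma measurable_gridCeil (δ : ℝ) : Measurable (gridCeil δ) := by
  unfold gridCeil
  exact ((measurable_from_nat.comp (Nat.measurable_ceil.comp (measurable_id.div_const δ)))).mul_const δ

lemma le_gridCeil {δ : ℝ} (hδ : 0 < δ) (s : ℝ) : s ≤ gridCeil δ s :=
  (div_le_iff₀ hδ).1 (Nat.le_ceil _)

lemma gridCeil_le {δ s : ℝ} (hδ : 0 < δ) (hs : 0 ≤ s) : gridCeil δ s ≤ s + δ := by
  have := (Nat.ceil_lt_add_one (div_nonneg hs hδ.le)).le
  calc gridCeil δ s ≤ (s / δ + 1) * δ := by unfold gridCeil; gcongr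
    _ = s + δ := by field_simp

/-- Riemann sums over a uniform grid are integrals of step functions. -/
lemma hasSum_grid {g : ℝ → ℝ} {δ : ℝ} (hδ : 0 < δ)
    (hg : IntegrableOn (fun s => g (gridCeil δ s)) (Set.Ioi 0)) :
    HasSum (fun n : ℕ => δ * g ((n + 1) * δ)) (∫ s in Set.Ioi 0, g (gridCeil δ s)) := by
  have hun : Set.Ioi (0 : ℝ) = ⋃ n : ℕ, Set.Ioc (n * δ) ((n + 1) * δ) := by
    ext s
    simp only [Set.mem_Ioi, Set.mem_iUnion, Set.mem_Ioc]
    constructor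
    · intro hs
      have h1 : 0 < ⌈s / δ⌉₊ := Nat.ceil_pos.2 (by positivity)
      obtain ⟨m, hm⟩ := Nat.exists_eq_add_one.2 h1
      have h2 := Nat.ceil_lt_add_one (div_nonneg hs.le hδ.le)
      have h3 := Nat.le_ceil (s / δ)
      rw [hm] at h2 h3
      push_cast at h2 h3
      exact ⟨m, by rw [← lt_div_iff₀ hδ]; linarith, by rw [← div_le_iff₀ hδ]; exact h3⟩
    · rintro ⟨n, h1, -⟩
      exact lt_of_le_of_lt (by positivity) h1
  have hdisj : Pairwise (Function.onFun Disjoint fun n : ℕ => Set.Ioc (n * δ) ((n + 1) * δ)) := by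
    have hm : Monotone fun n : ℕ => (n : ℝ) * δ := fun m n h => by
      have : (m : ℝ) ≤ n := by exact_mod_cast h
      simp only; gcongr
    simpa using hm.pairwise_disjoint_on_Ioc_succ
  rw [hun] at hg ⊢
  have := hasSum_integral_iUnion (μ := volume) (fun n : ℕ => measurableSet_Ioc) hdisj hg
  refine this.congr_fun fun n => ?_
  have hpt : ∀ s ∈ Set.Ioc ((n : ℝ) * δ) ((n + 1) * δ), g (gridCeil δ s) = g ((n + 1) * δ) := by
    rintro s ⟨h1, h2⟩
    have : ⌈s / δ⌉₊ = n + 1 := by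
      rw [Nat.ceil_eq_iff (by omega)]
      push_cast
      exact ⟨by rw [lt_div_iff₀ hδ]; simpa using h1, by rwa [div_le_iff₀ hδ]⟩
    unfold gridCeil
    rw [this]; push_cast; rfl
  rw [setIntegral_congr_fun measurableSet_Ioc hpt, setIntegral_const, measureReal_def,
    Real.volume_Ioc, ENNReal.toReal_ofReal (by linarith)]
  simp only [smul_eq_mul]; ring

lemma kernel_gridCeil_le {a b c δ s : ℝ} (ha : 0 ≤ a) (hb : 0 ≤ b) (hc : 0 ≤ c) (hδ : 0 < δ)
    (hs : 0 < s) : kernel a b c (gridCeil δ s) ≤ kernel a b c s :=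
  kernel_anti ha hb hc hs (le_gridCeil hδ s)

lemma integrableOn_kernel_gridCeil {a b c δ : ℝ} (ha0 : 0 ≤ a) (ha : a < 1) (hb : 1 < b)
    (hc : 0 ≤ c) (hδ : 0 < δ) :
    IntegrableOn (fun s => kernel a b c (gridCeil δ s)) (Set.Ioi 0) := by
  refine (integrable_kernel ha hb hc).integrableOn.mono'
    ((measurable_kernel a b c).comp (measurable_gridCeil δ)).aestronglyMeasurable ?_
  filter_upwards [ae_restrict_mem measurableSet_Ioi] with s hs
  rw [Real.norm_of_nonneg (kernel_nonneg hc _)]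
  exact kernel_gridCeil_le ha0 (by linarith) hc hδ hs

/-- The symbol of the one-dimensional walk, with the sum folded onto the positive integers. -/
noncomputable def symbol (α θ : ℝ) : ℝ :=
  ∑' n : ℕ, 2 * ((1 - Real.cos ((n + 1) * θ)) / ((n : ℝ) + 1) ^ (1 + α))

/-- The jump density whose integral is the constant `Gtilde 1 α`. -/
noncomputable def jump (α s : ℝ) : ℝ := (1 - Real.cos s) / |s| ^ (1 + α)

lemma jump_nonneg (α s : ℝ) : 0 ≤ jump α s :=
  div_nonneg (by linarith [Real.cos_le_one s]) (by positivity)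

lemma measurable_jump (α : ℝ) : Measurable (jump α) := by
  unfold jump; fun_prop

lemma abs_cos_sub_cos_div_le {α a b s : ℝ} (hs : 0 < s) (hab : |a - b| ≤ s) :
    |Real.cos a - Real.cos b| / s ^ (1 + α) ≤ kernel α (1 + α) 2 s := by
  have h1 := (Real.abs_cos_sub_cos_le a b).trans hab
  have h2 : |Real.cos a - Real.cos b| ≤ 2 := by
    rw [abs_le]
    constructor <;> linarith [Real.cos_le_one a, Real.cos_le_one b, Real.neg_one_le_cos a,
      Real.neg_one_le_cos b]
  unfold kernel
  rw [abs_of_pos hs, le_min_iff]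
  constructor
  · calc _ ≤ s / s ^ (1 + α) := by gcongr
      _ = s ^ (-α) := by
        rw [Real.rpow_add hs, Real.rpow_one, Real.rpow_neg hs.le]; field_simp
  · calc _ ≤ 2 / s ^ (1 + α) := by gcongr
      _ = 2 * s ^ (-(1 + α)) := by rw [Real.rpow_neg hs.le]; rfl

lemma jump_le_kernel {α s : ℝ} (hs : 0 < s) : jump α s ≤ kernel α (1 + α) 2 s := by
  have := abs_cos_sub_cos_div_le (α := α) (a := 0) (b := s) hs (by simp [abs_of_pos hs])
  rw [Real.cos_zero, abs_of_nonneg (by linarith [Real.cos_le_one s])] at this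
  unfold jump
  rwa [abs_of_pos hs]

lemma integrableOn_jump_gridCeil {α δ : ℝ} (h0 : 0 < α) (h1 : α < 1) (hδ : 0 < δ) :
    IntegrableOn (fun s => jump α (gridCeil δ s)) (Set.Ioi 0) := by
  refine (integrableOn_kernel_gridCeil h0.le h1 (b := 1 + α) (by linarith) zero_le_two hδ).mono'
    ((measurable_jump α).comp (measurable_gridCeil δ)).aestronglyMeasurable ?_
  filter_upwards [ae_restrict_mem measurableSet_Ioi] with s hs
  rw [Real.norm_of_nonneg (jump_nonneg _ _)]
  exact jump_le_kernel (lt_of_lt_of_le hs (le_gridCeil hδ s))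

lemma mul_grid_rpow {α δ : ℝ} (hδ : 0 < δ) (c : ℝ) (n : ℕ) :
    c / ((n : ℝ) + 1) ^ (1 + α) = δ ^ α * (δ * (c / ((n + 1) * δ) ^ (1 + α))) := by
  rw [Real.mul_rpow (by positivity) hδ.le, Real.rpow_add hδ, Real.rpow_one]
  field_simp

lemma hasSum_symbol {α θ : ℝ} (h0 : 0 < α) (h1 : α < 1) (hθ : 0 < θ) :
    HasSum (fun n : ℕ => 2 * ((1 - Real.cos ((n + 1) * θ)) / ((n : ℝ) + 1) ^ (1 + α)))
      (2 * (θ ^ α * ∫ s in Set.Ioi 0, jump α (gridCeil θ s))) := by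
  refine HasSum.mul_left 2 ?_
  refine (((hasSum_grid hθ (integrableOn_jump_gridCeil h0 h1 hθ)).mul_left (θ ^ α)).congr_fun
    fun n => ?_)
  rw [mul_grid_rpow hθ]
  unfold jump
  rw [abs_of_pos (by positivity)]

lemma symbol_neg (α θ : ℝ) : symbol α (-θ) = symbol α θ := by
  simp [symbol]

lemma symbol_zero (α : ℝ) : symbol α 0 = 0 := by simp [symbol]

lemma symbol_abs (α θ : ℝ) : symbol α |θ| = symbol α θ := by
  rcases abs_choice θ with h | h <;> rw [h]
  exact symbol_neg α θ

lemma summable_symbol {α : ℝ} (h0 : 0 < α) (h1 : α < 1) (θ : ℝ) :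
    Summable fun n : ℕ => 2 * ((1 - Real.cos ((n + 1) * θ)) / ((n : ℝ) + 1) ^ (1 + α)) := by
  rcases lt_trichotomy θ 0 with h | h | h
  · simpa using (hasSum_symbol h0 h1 (neg_pos.2 h)).summable
  · simp [h]
  · exact (hasSum_symbol h0 h1 h).summable

lemma symbol_periodic (α : ℝ) : Function.Periodic (symbol α) (2 * π) := by
  intro θ
  unfold symbol
  congr! 5 with n
  have := Real.cos_add_nat_mul_two_pi ((n + 1) * θ) (n + 1)
  push_cast at this
  rw [← this]; ring_nf

/-- The symbol is Hölder continuous of exponent `α`. -/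
lemma exists_holder {α : ℝ} (h0 : 0 < α) (h1 : α < 1) :
    ∃ C, 0 ≤ C ∧ ∀ θ θ', |symbol α θ - symbol α θ'| ≤ C * |θ - θ'| ^ α := by
  refine ⟨2 * ∫ s in Set.Ioi 0, kernel α (1 + α) 2 s, ?_, fun θ θ' => ?_⟩
  · have : 0 ≤ ∫ s in Set.Ioi 0, kernel α (1 + α) 2 s :=
      integral_nonneg fun s => kernel_nonneg zero_le_two s
    positivity
  rcases eq_or_ne θ θ' with rfl | hne
  · simp [Real.zero_rpow h0.ne']
  set δ := |θ - θ'| with hδd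
  have hδ : 0 < δ := abs_pos.2 (sub_ne_zero.2 hne)
  have hgi := integrableOn_kernel_gridCeil h0.le h1 (b := 1 + α) (by linarith) zero_le_two hδ
  have hs := ((hasSum_grid hδ hgi).mul_left (δ ^ α)).mul_left 2
  have hd := (summable_symbol h0 h1 θ).hasSum.sub (summable_symbol h0 h1 θ').hasSum
  have hle : |symbol α θ - symbol α θ'| ≤
      2 * (δ ^ α * ∫ s in Set.Ioi 0, kernel α (1 + α) 2 (gridCeil δ s)) := by
    have hb : ∀ n : ℕ, ‖2 * ((1 - Real.cos ((n + 1) * θ)) / ((n : ℝ) + 1) ^ (1 + α)) -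
        2 * ((1 - Real.cos ((n + 1) * θ')) / ((n : ℝ) + 1) ^ (1 + α))‖ ≤
        2 * (δ ^ α * (δ * kernel α (1 + α) 2 ((n + 1) * δ))) := by
      intro n
      have e : 2 * ((1 - Real.cos ((n + 1) * θ)) / ((n : ℝ) + 1) ^ (1 + α)) -
        2 * ((1 - Real.cos ((n + 1) * θ')) / ((n : ℝ) + 1) ^ (1 + α)) =
        2 * (-(Real.cos ((n + 1) * θ) - Real.cos ((n + 1) * θ')) /
          ((n : ℝ) + 1) ^ (1 + α)) := by ring
      rw [e, Real.norm_eq_abs, abs_mul, abs_div, abs_neg, abs_two,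
        abs_of_pos (by positivity : 0 < ((n : ℝ) + 1) ^ (1 + α)), mul_grid_rpow hδ]
      gcongr
      refine abs_cos_sub_cos_div_le (by positivity) ?_
      rw [← mul_sub, abs_mul, abs_of_pos (by positivity : (0 : ℝ) < n + 1)]
    have := tsum_of_norm_bounded hs hb
    rwa [hd.tsum_eq] at this
  refine hle.trans ?_
  rw [mul_assoc, mul_comm (∫ s in _, _)]
  gcongr 2 * (_ * ?_)
  exact setIntegral_mono_on hgi (integrable_kernel h1 (by linarith) zero_le_two).integrableOn
    measurableSet_Ioi fun s hs => kernel_gridCeil_le h0.le (by linarith) zero_le_two hδ hs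

lemma continuous_symbol {α : ℝ} (h0 : 0 < α) (h1 : α < 1) : Continuous (symbol α) := by
  obtain ⟨C, -, hC⟩ := exists_holder h0 h1
  rw [continuous_iff_continuousAt]
  intro θ
  rw [ContinuousAt, tendsto_iff_dist_tendsto_zero]
  have h : Tendsto (fun θ' => C * |θ' - θ| ^ α) (𝓝 θ) (𝓝 0) := by
    have : Continuous fun θ' : ℝ => C * |θ' - θ| ^ α :=
      continuous_const.mul ((continuous_abs.comp (continuous_id.sub continuous_const)).rpow_const
        fun _ => Or.inr h0.le)
    simpa [Real.zero_rpow h0.ne'] using this.tendsto θ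
  exact squeeze_zero (fun _ => dist_nonneg) (fun θ' => hC θ' θ) h

lemma symbol_pos {α θ : ℝ} (h0 : 0 < α) (h1 : α < 1) (hθ : 0 < |θ|) (hθ' : |θ| < 2 * π) :
    0 < symbol α θ := by
  rw [← symbol_abs]
  refine (summable_symbol h0 h1 |θ|).tsum_pos (fun n => ?_) 0 ?_
  · have := Real.cos_le_one ((n + 1) * |θ|)
    have : 0 ≤ 1 - Real.cos ((n + 1) * |θ|) := by linarith
    positivity
  · have : Real.cos |θ| < 1 := by
      refine lt_of_le_of_ne (Real.cos_le_one _) fun h => ?_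
      exact hθ.ne' ((Real.cos_eq_one_iff_of_lt_of_lt (by linarith [Real.pi_pos]) hθ').1 h)
    simpa using this

lemma tendsto_gridCeil {s : ℝ} (hs : 0 < s) :
    Tendsto (fun δ => gridCeil δ s) (𝓝[>] 0) (𝓝 s) := by
  have h : Tendsto (fun δ : ℝ => s + δ) (𝓝[>] 0) (𝓝 s) := by
    have : Tendsto (fun δ : ℝ => s + δ) (𝓝 0) (𝓝 (s + 0)) := tendsto_const_nhds.add tendsto_id
    rw [add_zero] at this
    exact this.mono_left nhdsWithin_le_nhds
  refine tendsto_of_tendsto_of_tendsto_of_le_of_le' tendsto_const_nhds h ?_ ?_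
  · filter_upwards [self_mem_nhdsWithin] with δ hδ using le_gridCeil hδ s
  · filter_upwards [self_mem_nhdsWithin] with δ hδ using gridCeil_le hδ hs.le

lemma integrable_jump {α : ℝ} (h0 : 0 < α) (h1 : α < 1) : Integrable (jump α) := by
  have h : IntegrableOn (jump α) (Set.Ioi 0) := by
    refine (integrable_kernel h1 (b := 1 + α) (by linarith) zero_le_two).integrableOn.mono'
      (measurable_jump α).aestronglyMeasurable ?_
    filter_upwards [ae_restrict_mem measurableSet_Ioi] with s hs
    rw [Real.norm_of_nonneg (jump_nonneg _ _)]
    exact jump_le_kernel hs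
  refine (integrable_comp_abs h).congr (Eventually.of_forall fun s => ?_)
  simp [jump]

lemma Gtilde_eq (α : ℝ) : Gtilde 1 α = ∫ s, jump α s := by
  rw [Gtilde, ← (volume_preserving_funUnique (Fin 1) ℝ).integral_comp
    (MeasurableEquiv.measurableEmbedding _)]
  refine integral_congr_ae (Eventually.of_forall fun v => ?_)
  simp [jump, l2norm, Real.sqrt_sq_eq_abs]

lemma Gtilde_eq_two_mul (α : ℝ) : Gtilde 1 α = 2 * ∫ s in Set.Ioi 0, jump α s := by
  rw [Gtilde_eq, ← integral_comp_abs]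
  simp [jump]

lemma Gtilde_pos {α : ℝ} (h0 : 0 < α) (h1 : α < 1) : 0 < Gtilde 1 α := by
  rw [Gtilde_eq, integral_pos_iff_support_of_nonneg (jump_nonneg α) (integrable_jump h0 h1)]
  have hsub : Set.Ioo 0 1 ⊆ Function.support (jump α) := by
    intro s hs
    have hcos : Real.cos s < 1 := by
      refine lt_of_le_of_ne (Real.cos_le_one _) fun h => ?_
      exact hs.1.ne' ((Real.cos_eq_one_iff_of_lt_of_lt (by linarith [Real.pi_pos, hs.1])
        (by linarith [Real.pi_gt_three, hs.2])).1 h)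
    have : 0 < |s| := abs_pos.2 hs.1.ne'
    exact (div_pos (sub_pos.2 hcos) (by positivity)).ne'
  refine lt_of_lt_of_le ?_ (measure_mono hsub)
  simp

lemma tendsto_symbol_div {α : ℝ} (h0 : 0 < α) (h1 : α < 1) :
    Tendsto (fun θ => symbol α θ / |θ| ^ α) (𝓝[≠] 0) (𝓝 (Gtilde 1 α)) := by
  have hpos : Tendsto (fun θ => symbol α θ / θ ^ α) (𝓝[>] 0) (𝓝 (Gtilde 1 α)) := by
    have hint : Tendsto (fun θ => ∫ s in Set.Ioi 0, jump α (gridCeil θ s)) (𝓝[>] 0)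
        (𝓝 (∫ s in Set.Ioi 0, jump α s)) := by
      refine tendsto_integral_filter_of_dominated_convergence (kernel α (1 + α) 2) ?_ ?_
        (integrable_kernel h1 (by linarith) zero_le_two).integrableOn ?_
      · exact Eventually.of_forall fun δ =>
          ((measurable_jump α).comp (measurable_gridCeil δ)).aestronglyMeasurable
      · filter_upwards [self_mem_nhdsWithin] with δ hδ
        filter_upwards [ae_restrict_mem measurableSet_Ioi] with s hs
        rw [Real.norm_of_nonneg (jump_nonneg _ _)]
        exact (jump_le_kernel (lt_of_lt_of_le hs (le_gridCeil hδ s))).trans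
          (kernel_gridCeil_le h0.le (by linarith) zero_le_two hδ hs)
      · filter_upwards [ae_restrict_mem measurableSet_Ioi] with s hs
        have hc : ContinuousAt (jump α) s := by
          have hs' : 0 < |s| := abs_pos.2 (ne_of_gt hs)
          unfold jump
          refine ContinuousAt.div (by fun_prop) ?_ (by positivity)
          exact continuous_abs.continuousAt.rpow_const (Or.inl hs'.ne')
        exact hc.tendsto.comp (tendsto_gridCeil hs)
    rw [Gtilde_eq_two_mul]
    refine (hint.const_mul 2).congr' ?_
    filter_upwards [self_mem_nhdsWithin] with θ hθ
    have hθ' : (0 : ℝ) < θ := hθ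
    rw [show symbol α θ = _ from (hasSum_symbol h0 h1 hθ).tsum_eq]
    field_simp
  have habs : Tendsto (fun θ : ℝ => |θ|) (𝓝[≠] 0) (𝓝[>] 0) := tendsto_norm_nhdsNE_zero
  refine (hpos.comp habs).congr fun θ => ?_
  simp [symbol_abs]

lemma exists_symbol_lower {α : ℝ} (h0 : 0 < α) (h1 : α < 1) :
    ∃ c, 0 < c ∧ ∀ θ, |θ| ≤ 3 * π / 2 → c * |θ| ^ α ≤ symbol α θ := by
  have hG := Gtilde_pos h0 h1
  have hev := (tendsto_symbol_div h0 h1).eventually (lt_mem_nhds (half_lt_self hG))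
  rw [eventually_nhdsWithin_iff, Metric.eventually_nhds_iff] at hev
  obtain ⟨r, hr, hr'⟩ := hev
  have hπ := Real.pi_pos
  obtain ⟨m, hm, hm'⟩ : ∃ m, 0 < m ∧ ∀ θ ∈ Set.Icc r (3 * π / 2), m ≤ symbol α θ := by
    rcases (Set.Icc r (3 * π / 2)).eq_empty_or_nonempty with he | hne
    · exact ⟨1, one_pos, by simp [he]⟩
    obtain ⟨x, hx, hmin⟩ := isCompact_Icc.exists_isMinOn hne (continuous_symbol h0 h1).continuousOn
    have hx0 : 0 < x := hr.trans_le hx.1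
    exact ⟨_, symbol_pos h0 h1 (abs_pos.2 hx0.ne')
      (by rw [abs_of_pos hx0]; linarith [hx.2]), fun θ hθ => hmin hθ⟩
  refine ⟨min (Gtilde 1 α / 2) (m / (3 * π / 2) ^ α), by positivity, fun θ hθ => ?_⟩
  rcases eq_or_ne θ 0 with rfl | hne
  · simp [Real.zero_rpow h0.ne', symbol_zero]
  have hp : 0 < |θ| := abs_pos.2 hne
  rcases lt_or_ge |θ| r with h | h
  · have := hr' (by simpa using h) hne
    rw [lt_div_iff₀ (by positivity)] at this
    refine le_trans ?_ this.le
    gcongr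
    exact min_le_left _ _
  · rw [← symbol_abs]
    refine le_trans ?_ (hm' _ ⟨h, hθ⟩)
    calc _ ≤ m / (3 * π / 2) ^ α * (3 * π / 2) ^ α := by
          gcongr
          exact min_le_right _ _
      _ = m := by field_simp

lemma latticeSymbol_one {α : ℝ} (h0 : 0 < α) (h1 : α < 1) (v : Fin 1 → ℝ) :
    latticeSymbol 1 α v = -symbol α (v 0) := by
  set θ := v 0 with hθ
  let f : ℤ → ℝ := fun y => (Real.cos (θ * y) - 1) / |(y : ℝ)| ^ (1 + α)
  have hf : ∀ y : Fin 1 → ℤ,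
      (Real.cos (∑ i, v i * (y i : ℝ)) - 1) / zl2 y ^ (((1 : ℕ) : ℝ) + α) = f (y 0) := by
    intro y
    simp [f, zl2, l2norm, Real.sqrt_sq_eq_abs, hθ]
  have hf0 : f 0 = 0 := by simp [f]
  have hfe : f.Even := by
    intro y
    simp [f]
  have e1 : latticeSymbol 1 α v = ∑' y, f y := by
    unfold latticeSymbol
    simp_rw [hf]
    rw [← (Equiv.funUnique (Fin 1) ℤ).tsum_eq f]
    refine tsum_subtype_eq_of_support_subset (s := {y : Fin 1 → ℤ | y ≠ 0})
      (f := fun y : Fin 1 → ℤ => f (y 0)) ?_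
    rintro y hy rfl
    exact hy hf0
  have hn : ∀ n : ℕ, f (n + 1 : ℕ) = -(2 * ((1 - Real.cos ((n + 1) * θ)) /
      ((n : ℝ) + 1) ^ (1 + α))) / 2 := by
    intro n
    have : (0 : ℝ) ≤ n + 1 := by positivity
    simp only [f]
    push_cast
    rw [abs_of_nonneg this, mul_comm θ]
    ring
  have hs : HasSum (fun n : ℕ => f (n + 1 : ℕ)) (-symbol α θ / 2) := by
    simp_rw [hn]
    exact (summable_symbol h0 h1 θ).hasSum.neg.div_const 2
  have hz : HasSum (fun n : ℕ => f n) (-symbol α θ / 2) := by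
    rw [← hasSum_nat_add_iff' 1]
    simpa [hf0] using hs
  have := hz.of_nat_of_neg_add_one (f := f) (m' := -symbol α θ / 2)
    (hs.congr_fun fun n => by rw [← hfe]; push_cast; rfl)
  rw [e1, this.tsum_eq]; ring

lemma intervalIntegrable_abs_rpow {α : ℝ} (h0 : 0 < α) (h1 : α < 1) (a b : ℝ) :
    IntervalIntegrable (fun u : ℝ => |u| ^ (-α)) volume a b := by
  set R := max |a| |b|
  have hR : 0 ≤ R := (abs_nonneg a).trans (le_max_left _ _)
  have hg : Integrable ((Set.Ioc 0 R).indicator fun u : ℝ => u ^ (-α)) := by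
    rw [integrable_indicator_iff measurableSet_Ioc,
      ← intervalIntegrable_iff_integrableOn_Ioc_of_le hR]
    exact intervalIntegral.intervalIntegrable_rpow' (by linarith)
  have hi := (integrable_comp_abs hg.integrableOn).intervalIntegrable (a := a) (b := b)
  refine hi.congr fun u hu => ?_
  have huR : |u| ≤ R := by
    rw [abs_le]
    have ha := abs_le.1 (le_max_left |a| |b|)
    have hb := abs_le.1 (le_max_right |a| |b|)
    rcases Set.mem_uIoc.1 hu with h | h <;> constructor <;> linarith [h.1, h.2, ha.1, ha.2, hb.1, hb.2]
  rcases (abs_nonneg u).eq_or_lt with h | h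
  · simp [← h, Real.zero_rpow (neg_ne_zero.2 h0.ne')]
  · simp [h, huR]

/-- The integrable function dominating the rescaled increments of `1 / symbol`. -/
noncomputable def incrementBound (α u : ℝ) : ℝ := |u| ^ (-α) * |u + π| ^ (-α)

lemma integrable_incrementBound {α : ℝ} (h0 : 1 / 2 < α) (h1 : α < 1) :
    Integrable (incrementBound α) := by
  have hk := integrable_kernel (a := α) (b := 2 * α) (c := 1) h1 (by linarith) zero_le_one
  have key : ∀ x y : ℝ, x ≠ 0 → |x| ≤ |y| → 1 ≤ |y| →
      |x| ^ (-α) * |y| ^ (-α) ≤ kernel α (2 * α) 1 x := by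
    intro x y hx hxy hy
    have hx' : 0 < |x| := abs_pos.2 hx
    unfold kernel
    rw [one_mul, le_min_iff]
    constructor
    · exact mul_le_of_le_one_right (by positivity)
        (Real.rpow_le_one_of_one_le_of_nonpos hy (by linarith))
    · calc _ ≤ |x| ^ (-α) * |x| ^ (-α) := by
            gcongr ?_ * ?_
            exact Real.rpow_le_rpow_of_nonpos hx' hxy (by linarith)
        _ = |x| ^ (-(2 * α)) := by rw [← Real.rpow_add hx']; ring_nf
  have hmeas : Measurable (incrementBound α) := by unfold incrementBound; fun_prop
  refine (hk.add (hk.comp_add_right π)).mono' hmeas.aestronglyMeasurable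
    (Eventually.of_forall fun u => ?_)
  have hn : 0 ≤ incrementBound α u := by unfold incrementBound; positivity
  rw [Real.norm_of_nonneg hn]
  have k1 := kernel_nonneg (a := α) (b := 2 * α) (c := 1) zero_le_one u
  have k2 := kernel_nonneg (a := α) (b := 2 * α) (c := 1) zero_le_one (u + π)
  simp only [Pi.add_apply]
  have hα : -α ≠ 0 := by linarith
  rcases eq_or_ne u 0 with h | hu
  · have e : incrementBound α u = 0 := by
      rw [incrementBound, h, abs_zero, Real.zero_rpow hα, zero_mul]
    rw [e]; positivity
  rcases eq_or_ne (u + π) 0 with h | hu'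
  · have e : incrementBound α u = 0 := by
      rw [incrementBound, h, abs_zero, Real.zero_rpow hα, mul_zero]
    rw [e]; positivity
  have hsum : π ≤ |u| + |u + π| := by
    calc π = |(u + π) - u| := by rw [add_sub_cancel_left, abs_of_pos Real.pi_pos]
      _ ≤ |u + π| + |u| := abs_sub _ _
      _ = _ := add_comm _ _
  have hπ := Real.pi_gt_three
  unfold incrementBound
  rcases le_total |u| |u + π| with h | h
  · linarith [key u (u + π) hu h (by linarith)]
  · rw [mul_comm]
    linarith [key (u + π) u hu' h (by linarith)]

/-- The limiting profile `1 / (G |u|^α)` of `1 / symbol` at the origin. -/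
noncomputable def profile (α u : ℝ) : ℝ := (Gtilde 1 α * |u| ^ α)⁻¹

lemma measurable_profile (α : ℝ) : Measurable (profile α) := by unfold profile; fun_prop

lemma profile_eq (α u : ℝ) : profile α u = (Gtilde 1 α)⁻¹ * |u| ^ (-α) := by
  rw [profile, mul_inv, Real.rpow_neg (abs_nonneg u)]

/-- The integrand of the limit after a half-period shift. -/
noncomputable def limitIntegrand (α u : ℝ) : ℝ := Real.cos u * (profile α u - profile α (u + π))

/-- The integrand of the rescaled Fourier coefficient after a half-period shift. -/
noncomputable def scaledIntegrand (α : ℝ) (n : ℕ) : ℝ → ℝ :=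
  (Set.Ioc (n * -π) (n * π)).indicator fun u =>
    Real.cos u * ((n : ℝ) ^ (-α) * ((symbol α (u / n))⁻¹ - (symbol α ((u + π) / n))⁻¹))

lemma exists_scaledIntegrand_le {α : ℝ} (h0 : 0 < α) (h1 : α < 1) :
    ∃ B, ∀ n : ℕ, 2 ≤ n → ∀ u, u ≠ 0 → u + π ≠ 0 →
      ‖scaledIntegrand α n u‖ ≤ B * incrementBound α u := by
  obtain ⟨C, hC0, hC⟩ := exists_holder h0 h1
  obtain ⟨c, hc0, hc⟩ := exists_symbol_lower h0 h1
  refine ⟨C * π ^ α / c ^ 2, fun n hn u hu hu' => ?_⟩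
  have hπ := Real.pi_pos
  have hn0 : (0 : ℝ) < n := by exact_mod_cast (by omega : 0 < n)
  have hn2 : (2 : ℝ) ≤ n := by exact_mod_cast hn
  have hb : 0 ≤ C * π ^ α / c ^ 2 * incrementBound α u := by
    unfold incrementBound; positivity
  by_cases hmem : u ∈ Set.Ioc (n * -π) (n * π)
  swap
  · rw [scaledIntegrand, Set.indicator_of_notMem hmem, norm_zero]; exact hb
  rw [scaledIntegrand, Set.indicator_of_mem hmem, Real.norm_eq_abs, abs_mul]
  refine (mul_le_of_le_one_left (abs_nonneg _) (Real.abs_cos_le_one u)).trans ?_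
  set θ := u / n with hθ
  set θ' := (u + π) / n with hθ'
  have hpn : π / n ≤ π / 2 := by gcongr
  have hpn0 : 0 < π / n := by positivity
  have hsub : θ' = θ + π / n := by rw [hθ, hθ', add_div]
  have l1 : -π < θ := by rw [hθ, lt_div_iff₀ hn0]; linarith [hmem.1]
  have l2 : θ ≤ π := by rw [hθ, div_le_iff₀ hn0]; linarith [hmem.2]
  have q1 := hc θ (abs_le.2 ⟨by linarith, by linarith⟩)
  have q2 := hc θ' (abs_le.2 ⟨by linarith, by linarith⟩)
  have p1 : 0 < |u| := abs_pos.2 hu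
  have p2 : 0 < |u + π| := abs_pos.2 hu'
  have e1 : |θ| = |u| / n := by rw [hθ, abs_div, abs_of_pos hn0]
  have e2 : |θ'| = |u + π| / n := by rw [hθ', abs_div, abs_of_pos hn0]
  rw [e1, Real.div_rpow (abs_nonneg _) hn0.le] at q1
  rw [e2, Real.div_rpow (abs_nonneg _) hn0.le] at q2
  have s1 : 0 < symbol α θ := lt_of_lt_of_le (by positivity) q1
  have s2 : 0 < symbol α θ' := lt_of_lt_of_le (by positivity) q2
  have hh := hC θ' θ
  rw [show θ' - θ = π / n by rw [hsub]; ring, abs_of_pos hpn0, Real.div_rpow hπ.le hn0.le] at hh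
  rw [abs_mul, inv_sub_inv s1.ne' s2.ne', abs_div, abs_of_pos (mul_pos s1 s2),
    abs_of_pos (by positivity : 0 < (n : ℝ) ^ (-α))]
  calc _ ≤ (n : ℝ) ^ (-α) * (C * (π ^ α / n ^ α) /
        ((c * (|u| ^ α / n ^ α)) * (c * (|u + π| ^ α / n ^ α)))) := by gcongr
    _ = _ := by
      unfold incrementBound
      rw [Real.rpow_neg hn0.le, Real.rpow_neg p1.le, Real.rpow_neg p2.le]
      field_simp

lemma tendsto_inv_symbol_div {α u : ℝ} (h0 : 0 < α) (h1 : α < 1) (hu : u ≠ 0) :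
    Tendsto (fun n : ℕ => (n : ℝ) ^ (-α) * (symbol α (u / n))⁻¹) atTop (𝓝 (profile α u)) := by
  have hG := Gtilde_pos h0 h1
  have hu' : 0 < |u| := abs_pos.2 hu
  have hlim : Tendsto (fun n : ℕ => u / (n : ℝ)) atTop (𝓝[≠] 0) := by
    refine tendsto_nhdsWithin_iff.2
      ⟨tendsto_const_nhds.div_atTop tendsto_natCast_atTop_atTop, ?_⟩
    filter_upwards [eventually_gt_atTop 0] with n hn
    exact div_ne_zero hu (by positivity)
  have h := (((tendsto_symbol_div h0 h1).comp hlim).mul_const (|u| ^ α)).inv₀ (by positivity)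
  refine h.congr' ?_
  filter_upwards [eventually_gt_atTop 0] with n hn
  have hn0 : (0 : ℝ) < n := by exact_mod_cast hn
  simp only [Function.comp_apply]
  rw [abs_div, abs_of_pos hn0, Real.div_rpow hu'.le hn0.le, Real.rpow_neg hn0.le, ← mul_inv]
  congr 1
  field_simp

lemma tendsto_scaledIntegrand {α u : ℝ} (h0 : 0 < α) (h1 : α < 1) (hu : u ≠ 0)
    (hu' : u + π ≠ 0) :
    Tendsto (fun n => scaledIntegrand α n u) atTop (𝓝 (limitIntegrand α u)) := by
  have h := ((tendsto_inv_symbol_div h0 h1 hu).sub (tendsto_inv_symbol_div h0 h1 hu')).const_mul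
    (Real.cos u)
  refine h.congr' ?_
  have h2 : Tendsto (fun n : ℕ => (n : ℝ) * π) atTop atTop :=
    tendsto_natCast_atTop_atTop.atTop_mul_const Real.pi_pos
  filter_upwards [h2.eventually_gt_atTop |u|] with n hn
  have h3 := abs_lt.1 hn
  have hmem : u ∈ Set.Ioc (n * -π) (n * π) := ⟨by linarith [h3.1], h3.2.le⟩
  rw [scaledIntegrand, Set.indicator_of_mem hmem]
  ring

lemma ae_ne_zero_and (s : ℝ) : ∀ᵐ u : ℝ, u ≠ 0 ∧ u + s ≠ 0 := by
  filter_upwards [volume.ae_ne 0, volume.ae_ne (-s)] with u h h'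
  exact ⟨h, fun h2 => h' (by linarith)⟩

lemma measurable_scaledIntegrand {α : ℝ} (h0 : 0 < α) (h1 : α < 1) (n : ℕ) :
    Measurable (scaledIntegrand α n) := by
  have := (continuous_symbol h0 h1).measurable
  unfold scaledIntegrand
  refine Measurable.indicator ?_ measurableSet_Ioc
  fun_prop

lemma integrable_limitIntegrand {α : ℝ} (h0 : 1 / 2 < α) (h1 : α < 1) :
    Integrable (limitIntegrand α) := by
  have h0' : 0 < α := by linarith
  obtain ⟨B, hB⟩ := exists_scaledIntegrand_le h0' h1
  have hm : Measurable (limitIntegrand α) := by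
    have := measurable_profile α
    unfold limitIntegrand
    fun_prop
  refine ((integrable_incrementBound h0 h1).const_mul B).mono' hm.aestronglyMeasurable ?_
  filter_upwards [ae_ne_zero_and π] with u hu
  refine le_of_tendsto (tendsto_scaledIntegrand h0' h1 hu.1 hu.2).norm ?_
  filter_upwards [eventually_ge_atTop 2] with n hn using hB n hn u hu.1 hu.2

lemma tendsto_integral_scaledIntegrand {α : ℝ} (h0 : 1 / 2 < α) (h1 : α < 1) :
    Tendsto (fun n => ∫ u, scaledIntegrand α n u) atTop (𝓝 (∫ u, limitIntegrand α u)) := by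
  have h0' : 0 < α := by linarith
  obtain ⟨B, hB⟩ := exists_scaledIntegrand_le h0' h1
  refine tendsto_integral_filter_of_dominated_convergence _
    (Eventually.of_forall fun n => (measurable_scaledIntegrand h0' h1 n).aestronglyMeasurable) ?_
    ((integrable_incrementBound h0 h1).const_mul B) ?_
  · filter_upwards [eventually_ge_atTop 2] with n hn
    filter_upwards [ae_ne_zero_and π] with u hu using hB n hn u hu.1 hu.2
  · filter_upwards [ae_ne_zero_and π] with u hu using tendsto_scaledIntegrand h0' h1 hu.1 hu.2

lemma inv_symbol_le {α : ℝ} (h0 : 0 < α) (h1 : α < 1) :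
    ∃ K, ∀ θ, |θ| ≤ 3 * π / 2 → ‖(symbol α θ)⁻¹‖ ≤ K * |θ| ^ (-α) := by
  obtain ⟨c, hc0, hc⟩ := exists_symbol_lower h0 h1
  refine ⟨c⁻¹, fun θ hθ => ?_⟩
  rcases eq_or_ne θ 0 with rfl | h
  · simp [symbol_zero, Real.zero_rpow (neg_ne_zero.2 h0.ne')]
  have hp : 0 < |θ| := abs_pos.2 h
  have h2 := hc θ hθ
  have h3 : 0 < c * |θ| ^ α := by positivity
  rw [Real.norm_of_nonneg (inv_nonneg.2 (h3.le.trans h2)), Real.rpow_neg hp.le, ← mul_inv]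
  gcongr

lemma intervalIntegrable_inv_symbol {α : ℝ} (h0 : 0 < α) (h1 : α < 1) {a b : ℝ}
    (ha : |a| ≤ 3 * π / 2) (hb : |b| ≤ 3 * π / 2) :
    IntervalIntegrable (fun θ => (symbol α θ)⁻¹) volume a b := by
  obtain ⟨K, hK⟩ := inv_symbol_le h0 h1
  refine ((intervalIntegrable_abs_rpow h0 h1 a b).const_mul K).mono_fun'
    (continuous_symbol h0 h1).measurable.inv.aestronglyMeasurable ?_
  filter_upwards [ae_restrict_mem measurableSet_uIoc] with θ hθ
  refine hK θ (abs_le.2 ?_)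
  have ha := abs_le.1 ha
  have hb := abs_le.1 hb
  rcases Set.mem_uIoc.1 hθ with h | h <;> constructor <;>
    linarith [h.1, h.2, ha.1, ha.2, hb.1, hb.2]

lemma fourier_inv_symbol {α : ℝ} (h0 : 0 < α) (h1 : α < 1) {n : ℕ} (hn : 2 ≤ n) :
    (n : ℝ) ^ (1 - α) * ∫ θ in (-π)..π, Real.cos (n * θ) * (symbol α θ)⁻¹ =
      (∫ u, scaledIntegrand α n u) / 2 := by
  have hπ := Real.pi_pos
  have hn0 : (0 : ℝ) < n := by exact_mod_cast (by omega : 0 < n)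
  have hn2 : (2 : ℝ) ≤ n := by exact_mod_cast hn
  have hpn : π / n ≤ π / 2 := by gcongr
  have hpn0 : 0 < π / n := by positivity
  set h : ℝ → ℝ := fun θ => Real.cos (n * θ) * (symbol α θ)⁻¹ with hh
  have hper : Function.Periodic h (2 * π) := by
    intro θ
    simp only [hh]
    rw [symbol_periodic α θ, mul_add, Real.cos_add_nat_mul_two_pi]
  have hint : ∀ a b : ℝ, |a| ≤ 3 * π / 2 → |b| ≤ 3 * π / 2 → IntervalIntegrable h volume a b :=
    fun a b ha hb => (intervalIntegrable_inv_symbol h0 h1 ha hb).continuousOn_mul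
      (by fun_prop)
  have hi1 : IntervalIntegrable h volume (-π) π :=
    hint _ _ (by rw [abs_neg, abs_of_pos hπ]; linarith) (by rw [abs_of_pos hπ]; linarith)
  have hi2 : IntervalIntegrable (fun θ => h (θ + π / n)) volume (-π) π := by
    have := (hint (-π + π / n) (π + π / n) (abs_le.2 ⟨by linarith, by linarith⟩)
      (abs_le.2 ⟨by linarith, by linarith⟩)).comp_add_right (π / n)
    simpa using this
  have hshift : ∫ θ in (-π)..π, h (θ + π / n) = ∫ θ in (-π)..π, h θ := by
    rw [intervalIntegral.integral_comp_add_right]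
    have := hper.intervalIntegral_add_eq (-π + π / n) (-π)
    convert! this using 2 <;> ring
  have h2J : 2 * ∫ θ in (-π)..π, h θ = ∫ θ in (-π)..π, (h θ + h (θ + π / n)) := by
    rw [intervalIntegral.integral_add hi1 hi2, hshift, two_mul]
  set k : ℝ → ℝ := fun u => Real.cos u * ((n : ℝ) ^ (-α) *
    ((symbol α (u / n))⁻¹ - (symbol α ((u + π) / n))⁻¹)) with hk
  have hpt : ∀ θ, h θ + h (θ + π / n) = (n : ℝ) ^ α * k (n * θ) := by
    intro θ
    have e1 : n * (θ + π / n) = n * θ + π := by field_simp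
    have e2 : (n * θ + π) / n = θ + π / n := by field_simp
    have e3 : n * θ / n = θ := by field_simp
    simp only [hh, hk]
    rw [e1, e2, e3, Real.cos_add_pi, Real.rpow_neg hn0.le]
    field_simp
    ring
  simp_rw [hpt] at h2J
  rw [intervalIntegral.integral_const_mul, intervalIntegral.integral_comp_mul_left _ hn0.ne'] at h2J
  have hR : ∫ u, scaledIntegrand α n u = ∫ u in (n * -π)..(n * π), k u := by
    rw [intervalIntegral.integral_of_le (by nlinarith), ← integral_indicator measurableSet_Ioc]
    rfl
  rw [hR, eq_div_iff two_ne_zero, mul_assoc, mul_comm _ (2 : ℝ), h2J, smul_eq_mul, Real.rpow_sub hn0,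
    Real.rpow_one]
  field_simp

lemma intervalIntegrable_cos_mul_profile {α : ℝ} (h0 : 0 < α) (h1 : α < 1) (a b : ℝ) :
    IntervalIntegrable (fun u => Real.cos u * profile α u) volume a b := by
  simp_rw [profile_eq]
  exact ((intervalIntegrable_abs_rpow h0 h1 a b).const_mul _).continuousOn_mul
    Real.continuous_cos.continuousOn

lemma abs_cos_mul_profile_le {α : ℝ} (h0 : 0 < α) (h1 : α < 1) {u t : ℝ} (ht : 0 < t)
    (hu : t ≤ |u|) : ‖Real.cos u * profile α u‖ ≤ (Gtilde 1 α)⁻¹ * t ^ (-α) := by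
  have hG := Gtilde_pos h0 h1
  rw [profile_eq, Real.norm_eq_abs, abs_mul]
  refine (mul_le_of_le_one_left (abs_nonneg _) (Real.abs_cos_le_one u)).trans ?_
  rw [abs_of_nonneg (by positivity)]
  gcongr ?_ * ?_
  exact Real.rpow_le_rpow_of_nonpos ht hu (by linarith)

lemma tendsto_integral_cos_mul_profile {α : ℝ} (h0 : 1 / 2 < α) (h1 : α < 1) :
    Tendsto (fun T : ℝ => ∫ u in (-T)..T, Real.cos u * profile α u) atTop
      (𝓝 ((∫ u, limitIntegrand α u) / 2)) := by
  have h0' : 0 < α := by linarith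
  have hπ := Real.pi_pos
  set g : ℝ → ℝ := fun u => Real.cos u * profile α u with hg
  have hi : ∀ a b, IntervalIntegrable g volume a b := intervalIntegrable_cos_mul_profile h0' h1
  have hlim : ∀ u, limitIntegrand α u = g u + g (u + π) := by
    intro u
    simp only [limitIntegrand, hg, Real.cos_add_pi]
    ring
  have hmain := intervalIntegral_tendsto_integral (integrable_limitIntegrand h0 h1)
    tendsto_neg_atTop_atBot tendsto_id
  have hbd : Tendsto (fun T : ℝ => (Gtilde 1 α)⁻¹ * (T - π) ^ (-α) * π) atTop (𝓝 0) := by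
    have h : Tendsto (fun T : ℝ => T - π) atTop atTop :=
      tendsto_atTop_add_const_right _ (-π) tendsto_id
    simpa using (((tendsto_rpow_neg_atTop h0').comp h).const_mul (Gtilde 1 α)⁻¹).mul_const π
  have hbound : ∀ a T : ℝ, π < T → (∀ u ∈ Set.uIoc a (a + π), T - π ≤ |u|) →
      ‖∫ u in a..(a + π), g u‖ ≤ (Gtilde 1 α)⁻¹ * (T - π) ^ (-α) * π := by
    intro a T hT ha
    have := intervalIntegral.norm_integral_le_of_norm_le_const fun u hu =>
      abs_cos_mul_profile_le h0' h1 (sub_pos.2 hT) (ha u hu)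
    simpa [abs_of_pos hπ] using this
  have hr : Tendsto (fun T : ℝ => ∫ u in T..(T + π), g u) atTop (𝓝 0) := by
    refine squeeze_zero_norm' ?_ hbd
    filter_upwards [eventually_gt_atTop π] with T hT
    refine hbound T T hT fun u hu => ?_
    rw [Set.uIoc_of_le (by linarith)] at hu
    linarith [hu.1, le_abs_self u]
  have hl : Tendsto (fun T : ℝ => ∫ u in (-T)..(-T + π), g u) atTop (𝓝 0) := by
    refine squeeze_zero_norm' ?_ hbd
    filter_upwards [eventually_gt_atTop π] with T hT
    refine hbound (-T) T hT fun u hu => ?_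
    rw [Set.uIoc_of_le (by linarith)] at hu
    linarith [hu.2, neg_abs_le u]
  have := ((hmain.add hl).sub hr).div_const 2
  rw [add_zero, sub_zero] at this
  refine this.congr fun T => ?_
  simp_rw [hlim, id]
  have hsh : IntervalIntegrable (fun u => g (u + π)) volume (-T) T := by
    simpa using (hi (-T + π) (T + π)).comp_add_right π
  rw [intervalIntegral.integral_add (hi _ _) hsh, intervalIntegral.integral_comp_add_right]
  have e1 := intervalIntegral.integral_add_adjacent_intervals (hi (-T) (-T + π))
    (hi (-T + π) (T + π))
  have e2 := intervalIntegral.integral_add_adjacent_intervals (hi (-T) T) (hi T (T + π))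
  linarith

lemma strictConvexOn_rpow_neg {α : ℝ} (h0 : 0 < α) :
    StrictConvexOn ℝ (Set.Ioi 0) fun u : ℝ => u ^ (-α) := by
  refine StrictMonoOn.strictConvexOn_of_deriv (convex_Ioi 0)
    (fun u hu => (Real.continuousAt_rpow_const u _ (Or.inl (ne_of_gt hu))).continuousWithinAt) ?_
  rw [interior_Ioi]
  intro x hx y hy hxy
  have hx' : (0 : ℝ) < x := hx
  rw [Real.deriv_rpow_const, Real.deriv_rpow_const]
  have := Real.rpow_lt_rpow_of_neg hx' hxy (by linarith : -α - 1 < 0)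
  nlinarith

/-- Over a full period of the cosine starting at a maximum, a strictly convex weight has positive
cosine integral. -/
lemma integral_cos_mul_pos_of_strictConvexOn {w : ℝ → ℝ} (hw : StrictConvexOn ℝ (Set.Ioi 0) w)
    (m : ℕ) (hi : IntervalIntegrable (fun u => Real.cos u * w u) volume (m * (2 * π))
      ((m + 1) * (2 * π))) :
    0 < ∫ u in (m * (2 * π))..((m + 1) * (2 * π)), Real.cos u * w u := by
  have hπ := Real.pi_pos
  set a : ℝ := m * (2 * π) with ha
  have ha0 : 0 ≤ a := by positivity
  have hb : ((m : ℝ) + 1) * (2 * π) = a + 2 * π := by rw [ha]; ring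
  rw [hb] at hi ⊢
  set x := a + π / 2 with hx
  set y := a + 3 * π / 2 with hy
  have hxy : 0 < y - x := by rw [hx, hy]; linarith
  obtain ⟨q, hq⟩ : ∃ q, q = (w y - w x) / (y - x) := ⟨_, rfl⟩
  have hqy : q * (y - x) = w y - w x := by rw [hq]; field_simp
  have hcos : ∀ u, Real.cos u = Real.cos (u - a) := fun u =>
    (Real.cos_sub_nat_mul_two_pi u m).symm
  have hsin : ∀ u, Real.sin u = Real.sin (u - a) := fun u =>
    (Real.sin_sub_nat_mul_two_pi u m).symm
  let l : ℝ → ℝ := fun u => w x + q * (u - x)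
  have hlc : Continuous l := by fun_prop
  have hd : ∀ u, HasDerivAt (fun u => Real.sin u * l u + q * Real.cos u) (Real.cos u * l u) u := by
    intro u
    have h1 : HasDerivAt l q u := by
      simpa only [mul_one, id] using (((hasDerivAt_id u).sub_const x).const_mul q).const_add (w x)
    convert! ((Real.hasDerivAt_sin u).mul h1).add ((Real.hasDerivAt_cos u).const_mul q) using 1
    ring
  have hl0 : ∫ u in a..(a + 2 * π), Real.cos u * l u = 0 := by
    rw [intervalIntegral.integral_eq_sub_of_hasDerivAt (fun u _ => hd u)
      ((Real.continuous_cos.mul hlc).intervalIntegrable _ _)]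
    simp [hsin a, hcos a, hsin (a + 2 * π), hcos (a + 2 * π)]
  have hil : ∀ c d : ℝ, IntervalIntegrable (fun u => Real.cos u * l u) volume c d :=
    fun c d => (Real.continuous_cos.mul hlc).intervalIntegrable c d
  have hdiff : IntervalIntegrable (fun u => Real.cos u * (w u - l u)) volume a (a + 2 * π) := by
    simp_rw [mul_sub]
    exact hi.sub (hil _ _)
  have heq : ∫ u in a..(a + 2 * π), Real.cos u * w u =
      ∫ u in a..(a + 2 * π), Real.cos u * (w u - l u) := by
    simp_rw [mul_sub]
    rw [intervalIntegral.integral_sub hi (hil _ _), hl0, sub_zero]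
  have hx0 : 0 < x := by rw [hx]; linarith
  have hpos : ∀ u ∈ Set.Ioo a x, 0 < Real.cos u * (w u - l u) := by
    intro u hu
    have hc : 0 < Real.cos u := by
      rw [hcos]
      exact Real.cos_pos_of_mem_Ioo ⟨by linarith [hu.1], by linarith [hu.2]⟩
    have hs := hw.slope_strict_mono_adjacent (ha0.trans_lt hu.1) (by simp; linarith : y ∈ Set.Ioi 0)
      hu.2 (by linarith)
    rw [← hq, div_lt_iff₀ (by linarith [hu.2])] at hs
    exact mul_pos hc (by simp only [l]; linarith)
  have hnn : ∀ u ∈ Set.Icc x (a + 2 * π), 0 ≤ Real.cos u * (w u - l u) := by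
    intro u hu
    have hu0 : 0 < u := hx0.trans_le hu.1
    rcases hu.1.eq_or_lt with rfl | hxu
    · simp [l]
    rcases lt_trichotomy u y with huy | rfl | hyu
    · have hc : Real.cos u ≤ 0 := by
        rw [hcos]
        exact Real.cos_nonpos_of_pi_div_two_le_of_le (by linarith) (by linarith)
      have hs := hw.slope_strict_mono_adjacent hx0 (hu0.trans huy) hxu huy
      rw [div_lt_div_iff₀ (by linarith) (by linarith)] at hs
      have h3 : (w u - w x) * (y - x) < q * (u - x) * (y - x) := by
        calc _ < (w y - w x) * (u - x) := by linarith
          _ = _ := by rw [← hqy]; ring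
      have h4 := lt_of_mul_lt_mul_right h3 hxy.le
      exact mul_nonneg_of_nonpos_of_nonpos hc (by simp only [l]; linarith)
    · simp only [l]
      rw [hqy]; simp
    · have hc : 0 ≤ Real.cos u := by
        rw [hcos, ← Real.cos_sub_two_pi]
        exact Real.cos_nonneg_of_mem_Icc ⟨by linarith, by linarith [hu.2]⟩
      have hs := hw.slope_strict_mono_adjacent hx0 hu0 (by linarith : x < y) hyu
      rw [← hq, lt_div_iff₀ (by linarith)] at hs
      have : q * (u - x) = q * (u - y) + q * (y - x) := by ring
      exact mul_nonneg hc (by simp only [l]; linarith)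
  have hsub1 : IntervalIntegrable (fun u => Real.cos u * (w u - l u)) volume a x :=
    hdiff.mono_set (Set.uIcc_subset_uIcc_left (Set.mem_uIcc.2 (Or.inl ⟨by linarith, by linarith⟩)))
  have hsub2 : IntervalIntegrable (fun u => Real.cos u * (w u - l u)) volume x (a + 2 * π) :=
    hdiff.mono_set (Set.uIcc_subset_uIcc_right (Set.mem_uIcc.2 (Or.inl ⟨by linarith, by linarith⟩)))
  rw [heq, ← intervalIntegral.integral_add_adjacent_intervals hsub1 hsub2]
  exact add_pos_of_pos_of_nonneg
    (intervalIntegral.intervalIntegral_pos_of_pos_on hsub1 hpos (by linarith))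
    (intervalIntegral.integral_nonneg (by linarith) hnn)

lemma integral_limitIntegrand_pos {α : ℝ} (h0 : 1 / 2 < α) (h1 : α < 1) :
    0 < ∫ u, limitIntegrand α u := by
  have h0' : 0 < α := by linarith
  have hG := Gtilde_pos h0' h1
  set g : ℝ → ℝ := fun u => Real.cos u * profile α u with hg
  have hi : ∀ a b, IntervalIntegrable g volume a b := intervalIntegrable_cos_mul_profile h0' h1
  have hstep : ∀ m : ℕ, 0 < ∫ u in (m * (2 * π))..((m + 1) * (2 * π)), g u := by
    intro m
    have hw : StrictConvexOn ℝ (Set.Ioi 0) (profile α) := by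
      refine ⟨convex_Ioi 0, fun x hx y hy hxy a b ha hb hab => ?_⟩
      have hc := (strictConvexOn_rpow_neg h0').2 hx hy hxy ha hb hab
      have hz : 0 < a • x + b • y := by
        have hx' : 0 < x := hx
        have hy' : 0 < y := hy
        simp only [smul_eq_mul]; positivity
      simp only [profile_eq, abs_of_pos hz, abs_of_pos (show 0 < x from hx),
        abs_of_pos (show 0 < y from hy)]
      simp only [smul_eq_mul] at hc ⊢
      have := mul_lt_mul_of_pos_left hc (inv_pos.2 hG)
      linarith
    exact integral_cos_mul_pos_of_strictConvexOn hw m (hi _ _)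
  set b : ℕ → ℝ := fun m => ∫ u in (0 : ℝ)..(m * (2 * π)), g u with hb
  have hbs : ∀ m, b m < b (m + 1) := by
    intro m
    have := intervalIntegral.integral_add_adjacent_intervals (hi 0 (m * (2 * π)))
      (hi (m * (2 * π)) ((m + 1) * (2 * π)))
    simp only [hb]
    push_cast
    rw [← this]
    linarith [hstep m]
  have hmono : StrictMono b := strictMono_nat_of_lt_succ hbs
  have hb0 : b 0 = 0 := by simp [hb]
  have htwo : ∀ m : ℕ, ∫ u in (-(m * (2 * π)))..(m * (2 * π)), g u = 2 * b m := by
    intro m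
    have hneg : ∫ u in (-(m * (2 * π)))..0, g u = b m := by
      have := intervalIntegral.integral_comp_neg (a := 0) (b := m * (2 * π)) g
      rw [neg_zero] at this
      rw [← this]
      simp [hb, hg, profile]
    rw [← intervalIntegral.integral_add_adjacent_intervals (hi _ 0) (hi 0 _), hneg,
      two_mul (b m)]
  have hT : Tendsto (fun m : ℕ => (m : ℝ) * (2 * π)) atTop atTop :=
    tendsto_natCast_atTop_atTop.atTop_mul_const Real.two_pi_pos
  have hlim := (tendsto_integral_cos_mul_profile h0 h1).comp hT
  have hge : 2 * b 1 ≤ (∫ u, limitIntegrand α u) / 2 := by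
    refine ge_of_tendsto hlim ?_
    filter_upwards [eventually_ge_atTop 1] with m hm
    simp only [Function.comp_apply]
    rw [htwo]
    linarith [hmono.monotone hm]
  have hb1 := hmono (zero_lt_one)
  rw [hb0] at hb1
  linarith

lemma pTrans_one {α : ℝ} (h0 : 0 < α) (h1 : α < 1) (s : ℝ) (x : ℤ) :
    pTrans 1 α s (fun _ => x) = (2 * π)⁻¹ *
      ∫ θ in Set.Icc (-π) π, Real.exp (-symbol α θ * s) * Real.cos (x * θ) := by
  unfold pTrans
  rw [← (volume_preserving_funUnique (Fin 1) ℝ).setIntegral_preimage_emb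
    (MeasurableEquiv.measurableEmbedding _), pow_one]
  congr 1
  have hset : (Set.univ.pi fun _ : Fin 1 => Set.Icc (-π) π) =
      (MeasurableEquiv.funUnique (Fin 1) ℝ) ⁻¹' Set.Icc (-π) π := by
    ext v
    simp only [Set.mem_univ_pi, Set.mem_preimage, MeasurableEquiv.funUnique_apply]
    exact ⟨fun h => h _, fun h i => Subsingleton.elim default i ▸ h⟩
  rw [hset]
  refine integral_congr_ae (Eventually.of_forall fun v => ?_)
  simp [latticeSymbol_one h0 h1, mul_comm s]

lemma integral_pTrans {α : ℝ} (h0 : 0 < α) (h1 : α < 1) (x : ℤ) :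
    ∫ s in Set.Ioi (0 : ℝ), pTrans 1 α s (fun _ => x) =
      (2 * π)⁻¹ * ∫ θ in (-π)..π, Real.cos (x * θ) * (symbol α θ)⁻¹ := by
  have hπ := Real.pi_pos
  have hm := (continuous_symbol h0 h1).measurable
  simp_rw [pTrans_one h0 h1]
  rw [integral_const_mul, intervalIntegral.integral_of_le (by linarith),
    ← integral_Icc_eq_integral_Ioc]
  congr 1
  have hpos : ∀ᵐ θ ∂volume.restrict (Set.Icc (-π) π), 0 < symbol α θ := by
    filter_upwards [ae_restrict_mem measurableSet_Icc, ae_restrict_of_ae (volume.ae_ne 0)]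
      with θ hθ hθ0
    exact symbol_pos h0 h1 (abs_pos.2 hθ0) (lt_of_le_of_lt (abs_le.2 hθ) (by linarith))
  have hexp : ∀ θ, 0 < symbol α θ →
      ∫ s in Set.Ioi (0 : ℝ), Real.exp (-symbol α θ * s) = (symbol α θ)⁻¹ := by
    intro θ hθ
    rw [integral_exp_mul_Ioi (neg_lt_zero.2 hθ)]
    simp [neg_div_neg_eq]
  rw [integral_integral_swap]
  · refine integral_congr_ae ?_
    filter_upwards [hpos] with θ hθ
    rw [integral_mul_const, hexp θ hθ, mul_comm]
  · have hmeas : Measurable (Function.uncurry fun s θ : ℝ =>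
        Real.exp (-symbol α θ * s) * Real.cos (x * θ)) := by
      simp only [Function.uncurry_def]
      fun_prop
    rw [integrable_prod_iff' hmeas.aestronglyMeasurable]
    constructor
    · filter_upwards [hpos] with θ hθ
      exact (exp_neg_integrableOn_Ioi 0 hθ).integrable.mul_const (Real.cos (x * θ))
    · have hI : IntegrableOn (fun θ => (symbol α θ)⁻¹) (Set.Icc (-π) π) := by
        rw [integrableOn_Icc_iff_integrableOn_Ioc,
          ← intervalIntegrable_iff_integrableOn_Ioc_of_le (by linarith)]
        exact intervalIntegrable_inv_symbol h0 h1 (by rw [abs_neg, abs_of_pos hπ]; linarith)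
          (by rw [abs_of_pos hπ]; linarith)
      have hJ : Integrable (fun θ => (symbol α θ)⁻¹ * |Real.cos (x * θ)|)
          (volume.restrict (Set.Icc (-π) π)) := by
        have hmeas' : Measurable fun θ => (symbol α θ)⁻¹ * |Real.cos (x * θ)| := by fun_prop
        refine Integrable.mono hI hmeas'.aestronglyMeasurable
          (Eventually.of_forall fun θ => ?_)
        rw [norm_mul, Real.norm_eq_abs |_|, abs_abs]
        exact mul_le_of_le_one_right (norm_nonneg _) (Real.abs_cos_le_one _)
      refine hJ.congr ?_
      filter_upwards [hpos] with θ hθ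
      simp only [Function.uncurry_apply_pair, norm_mul, Real.norm_eq_abs, Real.abs_exp]
      rw [integral_mul_const, hexp θ hθ]

end LongRangeWalk

/-- **Green's function asymptotics (equation 4.10, `d = 1`)**: for `1/2 < α < 1` there is a
finite strictly positive limit `L` with
`L = (2π)⁻¹ lim_{T→∞} ∫_{−T}^{T} cos θ/(G̃^{1,α}|θ|^α) dθ` and
`lim_{|x|→∞, x ∈ Z} |x|^{1−α} ∫_0^∞ p_s^{1,α}(0,x) ds = L`
(the latter limit is along the cofinite filter on `Z`, i.e. `|x| → ∞`). -/
theorem green_function_asymptotics_d1 (α : ℝ) (hα0 : 1 / 2 < α) (hα1 : α < 1) :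
    ∃ L : ℝ, 0 < L ∧
      Tendsto
        (fun T : ℝ => (2 * Real.pi)⁻¹ *
          ∫ θ in Set.Icc (-T) T, Real.cos θ / (Gtilde 1 α * |θ| ^ α))
        atTop (𝓝 L) ∧
      Tendsto
        (fun x : ℤ =>
          |(x : ℝ)| ^ (1 - α) * ∫ s in Set.Ioi (0 : ℝ), pTrans 1 α s (fun _ : Fin 1 => x))
        Filter.cofinite (𝓝 L) := by
  have h0 : 0 < α := by linarith
  have hpos := LongRangeWalk.integral_limitIntegrand_pos hα0 hα1
  refine ⟨(2 * Real.pi)⁻¹ * ((∫ u, LongRangeWalk.limitIntegrand α u) / 2), by positivity, ?_, ?_⟩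
  · refine ((LongRangeWalk.tendsto_integral_cos_mul_profile hα0 hα1).const_mul _).congr' ?_
    filter_upwards [eventually_ge_atTop 0] with T hT
    rw [intervalIntegral.integral_of_le (by linarith), ← integral_Icc_eq_integral_Ioc]
    rfl
  · have hnat : Tendsto (fun n : ℕ => (n : ℝ) ^ (1 - α) * ((2 * Real.pi)⁻¹ *
        ∫ θ in (-Real.pi)..Real.pi, Real.cos (n * θ) * (LongRangeWalk.symbol α θ)⁻¹)) atTop
        (𝓝 ((2 * Real.pi)⁻¹ * ((∫ u, LongRangeWalk.limitIntegrand α u) / 2))) := by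
      refine (((LongRangeWalk.tendsto_integral_scaledIntegrand hα0 hα1).div_const 2).const_mul
        (2 * Real.pi)⁻¹).congr' ?_
      filter_upwards [eventually_ge_atTop 2] with n hn
      rw [← LongRangeWalk.fourier_inv_symbol h0 hα1 hn]
      ring
    have habs : Tendsto Int.natAbs cofinite atTop := by
      rw [← Nat.cofinite_eq_atTop]
      refine Tendsto.cofinite_of_finite_preimage_singleton fun n => ?_
      refine (Set.toFinite ({(n : ℤ), -(n : ℤ)} : Set ℤ)).subset fun z hz => ?_
      exact Int.natAbs_eq_iff.1 hz
    refine (hnat.comp habs).congr fun x => ?_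
    have hx : ((x.natAbs : ℕ) : ℝ) = |(x : ℝ)| := by rw [Nat.cast_natAbs, Int.cast_abs]
    simp only [Function.comp_apply]
    rw [LongRangeWalk.integral_pTrans h0 hα1, hx]
    have hcos : ∀ θ : ℝ, Real.cos (|(x : ℝ)| * θ) = Real.cos (x * θ) := by
      intro θ
      rcases abs_choice (x : ℝ) with h | h <;> rw [h]
      rw [neg_mul, Real.cos_neg]
    simp_rw [hcos]
end

section
/- Oscillatory integral estimate (equation A.9): for every real α with 1/2 < α < 1 and every ε ∈ (0, π), lim_{x→+∞} x^{α−1} · ∫_{εx}^{πx} θ^{−2α} · | Σ_{y=1}^{∞} sin(θ y / x)/y^{α} | dθ = 0, where the limit is taken as the real parameter x tends to +∞. -/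
open MeasureTheory Filter Topology

/-- The (conditionally convergent) sine series `Σ_{y≥1} sin(uy)/y^α`, understood as the
limit of its partial sums (junk value if the limit does not exist). -/
noncomputable def sinSeries (α : ℝ) (u : ℝ) : ℝ :=
  limUnder atTop (fun m : ℕ => ∑ k ∈ Finset.Icc 1 m, Real.sin (u * k) / (k : ℝ) ^ α)

theorem abs_sum_sin_mul_le (u : ℝ) (hu : 0 < Real.sin (u / 2)) (m : ℕ) :
    |∑ k ∈ Finset.range m, Real.sin (u * (k + 1 : ℕ))| ≤ 1 / Real.sin (u / 2) := by
  have telescope : ∀ m : ℕ, 2 * Real.sin (u / 2) *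
      ∑ k ∈ Finset.range m, Real.sin (u * (k + 1 : ℕ)) =
        Real.cos (u / 2) - Real.cos (u * m + u / 2) := by
    intro m
    induction m with
    | zero => simp
    | succ m ih =>
      rw [Finset.sum_range_succ, mul_add, ih]
      have h : u * m + u / 2 = u * (m + 1 : ℕ) - u / 2 := by push_cast; ring
      rw [h, Real.cos_sub, Real.cos_add]
      ring
  have h2 : |2 * Real.sin (u / 2) * ∑ k ∈ Finset.range m, Real.sin (u * (k + 1 : ℕ))| ≤ 2 := by
    rw [telescope m, abs_le]
    constructor <;> linarith [Real.cos_le_one (u / 2), Real.neg_one_le_cos (u / 2),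
      Real.cos_le_one (u * m + u / 2), Real.neg_one_le_cos (u * m + u / 2)]
  rw [abs_mul, abs_of_pos (by positivity)] at h2
  rw [le_div_iff₀ hu]
  linarith

theorem abs_sum_mul_le_of_antitone {a b : ℕ → ℝ} {B : ℝ} (ha : Antitone a) (ha0 : ∀ n, 0 ≤ a n)
    (hb : ∀ n, |∑ k ∈ Finset.range n, b k| ≤ B) (m : ℕ) :
    |∑ k ∈ Finset.range m, a k * b k| ≤ B * a 0 := by
  have hdiff : ∀ m : ℕ, |∑ k ∈ Finset.range m, a k * b k - a m * ∑ k ∈ Finset.range m, b k| ≤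
      B * (a 0 - a m) := by
    intro m
    induction m with
    | zero => simp
    | succ m ih =>
      have hstep : ∑ k ∈ Finset.range (m + 1), a k * b k -
          a (m + 1) * ∑ k ∈ Finset.range (m + 1), b k =
          (∑ k ∈ Finset.range m, a k * b k - a m * ∑ k ∈ Finset.range m, b k) +
            (a m - a (m + 1)) * ∑ k ∈ Finset.range (m + 1), b k := by
        simp only [Finset.sum_range_succ]
        ring
      have hle : 0 ≤ a m - a (m + 1) := sub_nonneg.2 (ha m.le_succ)
      rw [hstep]
      refine (abs_add_le _ _).trans ?_
      rw [abs_mul, abs_of_nonneg hle]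
      nlinarith [mul_le_mul_of_nonneg_left (hb (m + 1)) hle]
  have h1 := hdiff m
  have h2 : |a m * ∑ k ∈ Finset.range m, b k| ≤ a m * B := by
    rw [abs_mul, abs_of_nonneg (ha0 m)]
    exact mul_le_mul_of_nonneg_left (hb m) (ha0 m)
  have h3 := abs_add_le (∑ k ∈ Finset.range m, a k * b k - a m * ∑ k ∈ Finset.range m, b k)
    (a m * ∑ k ∈ Finset.range m, b k)
  rw [sub_add_cancel] at h3
  linarith

theorem abs_sinSeries_le {α : ℝ} (hα : 0 < α) {u : ℝ} (hu : 0 < Real.sin (u / 2)) :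
    |sinSeries α u| ≤ 1 / Real.sin (u / 2) := by
  set a : ℕ → ℝ := fun k => ((k + 1 : ℕ) : ℝ) ^ (-α) with ha_def
  set b : ℕ → ℝ := fun k => Real.sin (u * (k + 1 : ℕ)) with hb_def
  have ha : Antitone a := by
    intro m n hmn
    exact Real.rpow_le_rpow_of_nonpos (by positivity) (by exact_mod_cast Nat.succ_le_succ hmn)
      (by linarith)
  have ha0 : ∀ n, 0 ≤ a n := fun n => by positivity
  have ha_lim : Tendsto a atTop (𝓝 0) :=
    (tendsto_rpow_neg_atTop hα).comp
      (tendsto_natCast_atTop_atTop.comp (tendsto_add_atTop_nat 1))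
  have hb : ∀ n, |∑ k ∈ Finset.range n, b k| ≤ 1 / Real.sin (u / 2) := abs_sum_sin_mul_le u hu
  have hsum : (fun m : ℕ => ∑ k ∈ Finset.Icc 1 m, Real.sin (u * k) / (k : ℝ) ^ α) =
      fun m => ∑ k ∈ Finset.range m, a k * b k := by
    funext m
    induction m with
    | zero => simp
    | succ m ih =>
      rw [Finset.sum_Icc_succ_top (by omega), ih, Finset.sum_range_succ, ha_def, hb_def]
      simp only
      rw [Real.rpow_neg (by positivity), div_eq_inv_mul]
  obtain ⟨l, hl⟩ := cauchySeq_tendsto_of_complete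
    (ha.cauchySeq_series_mul_of_tendsto_zero_of_bounded ha_lim
      (z := b) (b := 1 / Real.sin (u / 2)) hb)
  simp only [smul_eq_mul] at hl
  rw [sinSeries, hsum, hl.limUnder_eq]
  refine le_of_tendsto hl.abs (Eventually.of_forall fun m => ?_)
  simpa [ha_def] using abs_sum_mul_le_of_antitone ha ha0 hb m

/-- **Oscillatory integral estimate (equation A.9)**: for `1/2 < α < 1` and `ε ∈ (0, π)`,
`lim_{x→∞} x^{α−1} ∫_{εx}^{πx} θ^{−2α} |Σ_{y≥1} sin(θy/x)/y^α| dθ = 0`,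
the limit being over real `x → +∞`. -/
theorem oscillatory_integral_estimate (α : ℝ) (hα0 : 1 / 2 < α) (hα1 : α < 1)
    (ε : ℝ) (hε0 : 0 < ε) (hεπ : ε < Real.pi) :
    Tendsto
      (fun x : ℝ => x ^ (α - 1) *
        ∫ θ in Set.Icc (ε * x) (Real.pi * x), θ ^ (-(2 * α)) * |sinSeries α (θ / x)|)
      atTop (𝓝 0) := by
  set B : ℝ := 1 / Real.sin (ε / 2) with hB
  have hsin : 0 < Real.sin (ε / 2) := Real.sin_pos_of_pos_of_lt_pi (by linarith) (by linarith)
  have hlim : Tendsto (fun x : ℝ => (ε ^ (-(2 * α)) * B * (Real.pi - ε)) * x ^ (-α))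
      atTop (𝓝 0) := by
    simpa using (tendsto_rpow_neg_atTop (y := α) (by linarith)).const_mul
      (ε ^ (-(2 * α)) * B * (Real.pi - ε))
  refine squeeze_zero_norm' ?_ hlim
  filter_upwards [eventually_gt_atTop 0] with x hx
  have hbound : ∀ θ ∈ Set.Icc (ε * x) (Real.pi * x),
      ‖θ ^ (-(2 * α)) * |sinSeries α (θ / x)|‖ ≤ (ε * x) ^ (-(2 * α)) * B := by
    rintro θ ⟨h1, h2⟩
    have hεx : 0 < ε * x := by positivity
    have hθ : 0 < θ := hεx.trans_le h1
    have h1' : ε ≤ θ / x := (le_div_iff₀ hx).2 h1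
    have h2' : θ / x ≤ Real.pi := (div_le_iff₀ hx).2 h2
    have hmono : Real.sin (ε / 2) ≤ Real.sin (θ / x / 2) :=
      Real.sin_le_sin_of_le_of_le_pi_div_two (by linarith) (by linarith) (by linarith)
    rw [norm_mul, Real.norm_eq_abs, Real.norm_eq_abs, abs_abs, abs_of_nonneg (by positivity)]
    gcongr ?_ * ?_
    · exact Real.rpow_le_rpow_of_nonpos hεx h1 (by linarith)
    · exact (abs_sinSeries_le (by linarith) (hsin.trans_le hmono)).trans
        (one_div_le_one_div_of_le hsin hmono)
  have hint := norm_setIntegral_le_of_norm_le_const (μ := volume) measure_Icc_lt_top hbound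
  rw [Real.volume_real_Icc_of_le (by gcongr)] at hint
  rw [norm_mul, Real.norm_of_nonneg (by positivity)]
  refine (mul_le_mul_of_nonneg_left hint (by positivity)).trans_eq ?_
  have hpow : x ^ (-α) = x ^ (α - 1) * x ^ (-(2 * α)) * x := by
    rw [← Real.rpow_add hx, ← Real.rpow_add_one hx.ne']
    congr 1
    ring
  rw [Real.mul_rpow hε0.le hx.le, hpow]
  ring
end
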